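/- arXiv:2111.08778 — 4 statements merged into one kernel-verified Lean document; each statement's English description precedes it below -/
import Mathlib

section
/- Let p > 2 be a prime and let j be an integer with (p+1)/2 ≤ j ≤ p−1. Then (3j+1) * binom(2j,j) * binom(3j,j) * binom(p+2j,3j+1) ≡ 2p * (-1)^j * binom(2j,j) modulo p^3. -/
/-- Both sides equal `(p + 2j)! / (j! (2j)! (p - 1 - j)!)`; here `p = j + k + 1`. -/
theorem mul_choose_mul_choose_eq (j k : ℕ) :
    (3 * j + 1) * (3 * j).choose j * (j + k + 1 + 2 * j).choose (3 * j + 1) =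
      (j + k + 1) * (j + k + 1 + 2 * j).choose (j + k + 1) * (j + k).choose j := by
  have h1 := Nat.add_choose_mul_factorial_mul_factorial j (2 * j)
  have h2 := Nat.add_choose_mul_factorial_mul_factorial (3 * j + 1) k
  have h3 := Nat.add_choose_mul_factorial_mul_factorial (j + k + 1) (2 * j)
  have h4 := Nat.add_choose_mul_factorial_mul_factorial j k
  rw [← Nat.choose_symm_add] at h1 h2 h3 h4
  rw [show j + 2 * j = 3 * j by ring] at h1
  rw [show 3 * j + 1 + k = j + k + 1 + 2 * j by ring, Nat.factorial_succ, ← h1] at h2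
  rw [Nat.factorial_succ (j + k), ← h4] at h3
  have hpos : 0 < j.factorial * (2 * j).factorial * k.factorial := by positivity
  refine Nat.eq_of_mul_eq_mul_right hpos ?_
  linear_combination h2 - h3

theorem choose_prime_sub_one_modEq {p : ℕ} (hp : p.Prime) {j : ℕ} (hj : j < p) :
    ((p - 1).choose j : ℤ) ≡ (-1) ^ j [ZMOD p] := by
  induction j with
  | zero => simp
  | succ j ih =>
    have hdvd : (p : ℤ) ∣ (p.choose (j + 1) : ℤ) :=
      Int.natCast_dvd_natCast.mpr (hp.dvd_choose_self (by omega) hj)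
    have hpascal : p.choose (j + 1) = (p - 1).choose j + (p - 1).choose (j + 1) := by
      rw [← Nat.choose_succ_succ, Nat.succ_eq_add_one, Nat.sub_add_cancel hp.one_le]
    rw [hpascal] at hdvd
    push_cast at hdvd
    have h := (Int.modEq_zero_iff_dvd.mpr hdvd).sub (ih (by omega))
    simpa [pow_succ] using h

/-- Lemma 2.2, second part: for a prime `p > 2` and `(p+1)/2 ≤ j ≤ p-1`,
`(3j+1) C(2j,j) C(3j,j) C(p+2j,3j+1) ≡ 2p (-1)^j C(2j,j) (mod p^3)` as integers. -/
theorem lemma_p2j_second (p : ℕ) (hp : p.Prime) (hp2 : 2 < p) (j : ℕ)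
    (hj1 : (p + 1) / 2 ≤ j) (hj2 : j ≤ p - 1) :
    (3 * (j : ℤ) + 1) * ((2 * j).choose j : ℤ) * ((3 * j).choose j : ℤ) *
        ((p + 2 * j).choose (3 * j + 1) : ℤ) ≡
      2 * (p : ℤ) * (-1) ^ j * ((2 * j).choose j : ℤ) [ZMOD (p : ℤ) ^ 3] := by
  have hodd : p % 2 = 1 := hp.eq_two_or_odd.resolve_left (by omega)
  have hjp : j < p := by omega
  have hcentral : (p : ℤ) ∣ ((2 * j).choose j : ℤ) :=
    Int.natCast_dvd_natCast.mpr (hp.dvd_choose hjp (by omega) (by omega))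
  have hlucas : ((p + 2 * j).choose p : ℤ) ≡ 2 [ZMOD p] := by
    have := Fact.mk hp
    have h := Choose.choose_modEq_choose_mod_mul_choose_div (p := p) (n := p + 2 * j) (k := p)
    have hdiv : (p + 2 * j) / p = 2 :=
      Nat.div_eq_of_lt_le (by omega) (by omega)
    simpa [hdiv, Nat.div_self hp.pos] using h
  have heq : (3 * (j : ℤ) + 1) * ((3 * j).choose j : ℤ) * ((p + 2 * j).choose (3 * j + 1) : ℤ) =
      p * ((p + 2 * j).choose p : ℤ) * ((p - 1).choose j : ℤ) := by
    obtain ⟨k, rfl⟩ := Nat.exists_eq_add_of_lt hjp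
    exact_mod_cast mul_choose_mul_choose_eq j k
  obtain ⟨c, hc⟩ := hcentral
  obtain ⟨d, hd⟩ := (hlucas.mul (choose_prime_sub_one_modEq hp hjp)).dvd
  refine Int.modEq_iff_dvd.mpr ⟨c * d, ?_⟩
  rw [hc]
  linear_combination (p : ℤ) ^ 2 * c * hd - p * c * heq
end

section
/- Let p > 3 be a prime. Then ∑_{k=0}^{(p-3)/2} binom(2k,k)^2 / ((2k+1) * 16^k) * H_{2k}^{(2)} ≡ −(5/4) * B_{p-3} modulo p, where the congruence is understood in the rational numbers. -/
/-- The generalized harmonic numbers of order 2, `H2 n = ∑_{k=1}^n 1/k^2`. -/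
def harmonic2 (n : ℕ) : ℚ := ∑ k ∈ Finset.range n, ((k : ℚ) + 1)⁻¹ ^ 2

open Finset

/-- The rational number `q` is `p`-integral with residue `z` modulo `p`. -/
def ReducesTo (p : ℕ) (q : ℚ) (z : ZMod p) : Prop :=
  ∃ a b : ℤ, (b : ZMod p) ≠ 0 ∧ q * b = a ∧ z * b = a

namespace ReducesTo

theorem intCast {p : ℕ} [Fact p.Prime] (a : ℤ) : ReducesTo p a a :=
  ⟨a, 1, by simp, by simp, by simp⟩

theorem natCast {p : ℕ} [Fact p.Prime] (a : ℕ) : ReducesTo p a a := by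
  simpa using intCast (p := p) a

variable {p : ℕ} [Fact p.Prime] {q q' : ℚ} {z z' : ZMod p}

theorem add (h : ReducesTo p q z) (h' : ReducesTo p q' z') : ReducesTo p (q + q') (z + z') := by
  obtain ⟨a, b, hb, h₁, h₂⟩ := h
  obtain ⟨a', b', hb', h₁', h₂'⟩ := h'
  refine ⟨a * b' + a' * b, b * b', ?_, ?_, ?_⟩
  · push_cast
    exact mul_ne_zero hb hb'
  · push_cast
    linear_combination (b' : ℚ) * h₁ + b * h₁'
  · push_cast
    linear_combination (b' : ZMod p) * h₂ + b * h₂'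

theorem mul (h : ReducesTo p q z) (h' : ReducesTo p q' z') : ReducesTo p (q * q') (z * z') := by
  obtain ⟨a, b, hb, h₁, h₂⟩ := h
  obtain ⟨a', b', hb', h₁', h₂'⟩ := h'
  refine ⟨a * a', b * b', ?_, ?_, ?_⟩
  · push_cast
    exact mul_ne_zero hb hb'
  · push_cast
    rw [← h₁, ← h₁']
    ring
  · push_cast
    rw [← h₂, ← h₂']
    ring

theorem inv (h : ReducesTo p q z) (hz : z ≠ 0) : ReducesTo p q⁻¹ z⁻¹ := by
  obtain ⟨a, b, hb, h₁, h₂⟩ := h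
  have ha : (a : ZMod p) ≠ 0 := h₂ ▸ mul_ne_zero hz hb
  have ha' : (a : ℚ) ≠ 0 := by
    intro h
    rw [Int.cast_eq_zero] at h
    simp [h] at ha
  have hq : q ≠ 0 := by
    rintro rfl
    simp [eq_comm] at h₁
    simp [h₁] at ha
  refine ⟨b, a, ha, ?_, ?_⟩
  · rw [← h₁]
    field_simp
  · rw [← h₂]
    field_simp

theorem div (h : ReducesTo p q z) (h' : ReducesTo p q' z') (hz : z' ≠ 0) :
    ReducesTo p (q / q') (z / z') := by
  rw [div_eq_mul_inv, div_eq_mul_inv]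
  exact h.mul (h'.inv hz)

theorem neg (h : ReducesTo p q z) : ReducesTo p (-q) (-z) := by
  simpa using (intCast (p := p) (-1)).mul h

theorem sub (h : ReducesTo p q z) (h' : ReducesTo p q' z') : ReducesTo p (q - q') (z - z') := by
  simpa [sub_eq_add_neg] using h.add h'.neg

theorem pow (h : ReducesTo p q z) (k : ℕ) : ReducesTo p (q ^ k) (z ^ k) := by
  induction k with
  | zero => simpa using natCast (p := p) 1
  | succ k ih =>
    rw [pow_succ, pow_succ]
    exact ih.mul h

theorem sum {ι : Type*} {s : Finset ι} {f : ι → ℚ} {g : ι → ZMod p}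
    (h : ∀ i ∈ s, ReducesTo p (f i) (g i)) : ReducesTo p (∑ i ∈ s, f i) (∑ i ∈ s, g i) := by
  classical
  induction s using Finset.induction_on with
  | empty => simpa using natCast (p := p) 0
  | insert i s hi ih =>
    rw [sum_insert hi, sum_insert hi]
    exact (h i (by simp)).add (ih fun j hj => h j (by simp [hj]))

theorem unique (h : ReducesTo p q z) (h' : ReducesTo p q z') : z = z' := by
  obtain ⟨a, b, hb, h₁, h₂⟩ := h
  obtain ⟨a', b', hb', h₁', h₂'⟩ := h'
  have h : a * b' = a' * b := by
    have : (a * b' : ℚ) = a' * b := by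
      rw [← h₁, ← h₁']
      ring
    exact_mod_cast this
  have h : (a * b' : ZMod p) = a' * b := by exact_mod_cast congrArg (Int.cast : ℤ → ZMod p) h
  rw [← h₂, ← h₂'] at h
  apply mul_right_cancel₀ (mul_ne_zero hb hb')
  linear_combination h

theorem dvd_num (h : ReducesTo p q 0) : (p : ℤ) ∣ q.num := by
  obtain ⟨a, b, hb, h₁, h₂⟩ := h
  rw [zero_mul, eq_comm, ZMod.intCast_zmod_eq_zero_iff_dvd] at h₂
  rw [Ne, ZMod.intCast_zmod_eq_zero_iff_dvd] at hb
  have hd : q * q.den = q.num := Rat.mul_den_eq_num q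
  have h : q.num * b = a * q.den := by
    have : (q.num * b : ℚ) = a * q.den := by
      rw [← h₁, ← hd]
      ring
    exact_mod_cast this
  have hp : Prime (p : ℤ) := Nat.prime_iff_prime_int.mp Fact.out
  exact (hp.dvd_or_dvd (h ▸ h₂.mul_right _)).resolve_right hb

end ReducesTo

section Bernoulli

variable {p : ℕ} [Fact p.Prime]

theorem natCast_zmod_ne_zero {k : ℕ} (h₀ : 0 < k) (h : k < p) : (k : ZMod p) ≠ 0 := by
  rw [Ne, ZMod.natCast_eq_zero_iff]
  exact Nat.not_dvd_of_pos_of_lt h₀ h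

theorem exists_reducesTo_bernoulli (k : ℕ) (hk : k + 1 < p) :
    ∃ z : ZMod p, ReducesTo p (bernoulli k) z := by
  induction k using Nat.strong_induction_on with
  | _ k ih =>
    have h := sum_bernoulli (k + 1)
    rw [sum_range_succ] at h
    have hB : bernoulli k = (((if k + 1 = 1 then 1 else 0 : ℕ) : ℚ) -
        ∑ i ∈ range k, ((k + 1).choose i : ℚ) * bernoulli i) / ((k + 1 : ℕ) : ℚ) := by
      rw [eq_div_iff (by positivity)]
      rw [Nat.choose_succ_self_right] at h
      push_cast at h ⊢
      linear_combination h
    have h' : ∀ i, ∃ z : ZMod p, i ∈ range k → ReducesTo p (bernoulli i) z := by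
      intro i
      by_cases hi : i < k
      · obtain ⟨z, hz⟩ := ih i hi (by omega)
        exact ⟨z, fun _ => hz⟩
      · exact ⟨0, fun h => absurd (mem_range.mp h) hi⟩
    choose z hz using h'
    rw [hB]
    exact ⟨_, ((ReducesTo.natCast _).sub (ReducesTo.sum fun i hi =>
      (ReducesTo.natCast _).mul (hz i hi))).div (ReducesTo.natCast _)
        (natCast_zmod_ne_zero (by omega) hk)⟩

/-- Faulhaber's formula modulo `p`. -/
theorem exists_sum_range_pow_eq (m : ℕ) (hm : m + 2 < p) {b : ZMod p}
    (hb : ReducesTo p (bernoulli m) b) :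
    ∃ ρ : ℕ → ZMod p, ρ 0 = b ∧ (∀ i : ℕ,
      ∑ a ∈ range i, (a : ZMod p) ^ m = ∑ e ∈ range (m + 1), ρ e * (i : ZMod p) ^ (e + 1)) ∧
      ReducesTo p ((∑ a ∈ range p, (a : ℚ) ^ m) / p) b := by
  have h' : ∀ i, ∃ z : ZMod p, i < m + 1 →
      ReducesTo p (bernoulli (m - i) * ((m + 1).choose (m - i)) / (m + 1 : ℕ)) z := by
    intro i
    obtain ⟨z, hz⟩ := exists_reducesTo_bernoulli (p := p) (m - i) (by omega)
    exact ⟨_, fun _ => (hz.mul (ReducesTo.natCast _)).div (ReducesTo.natCast (m + 1))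
      (natCast_zmod_ne_zero (by omega) (by omega))⟩
  choose ρ hρ using h'
  have hF : ∀ i : ℕ, ∑ a ∈ range i, (a : ℚ) ^ m = ∑ e ∈ range (m + 1),
      (bernoulli (m - e) * ((m + 1).choose (m - e)) / (m + 1 : ℕ)) * (i : ℚ) ^ (e + 1) := by
    intro i
    rw [sum_range_pow, ← sum_range_reflect]
    refine sum_congr rfl fun e he => ?_
    rw [mem_range] at he
    rw [show m + 1 - 1 - e = m - e by omega, show m + 1 - (m - e) = e + 1 by omega]
    push_cast
    ring
  have h0 : ρ 0 = b := by
    refine (hρ 0 (by omega)).unique ?_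
    convert hb using 1
    rw [Nat.sub_zero, Nat.choose_succ_self_right]
    field_simp
  refine ⟨ρ, h0, fun i => ?_, ?_⟩
  · have h₁ : ReducesTo p (∑ a ∈ range i, (a : ℚ) ^ m) (∑ a ∈ range i, (a : ZMod p) ^ m) :=
      ReducesTo.sum fun a _ => (ReducesTo.natCast a).pow m
    refine h₁.unique ?_
    rw [hF]
    exact ReducesTo.sum fun e he =>
      (hρ e (mem_range.mp he)).mul ((ReducesTo.natCast i).pow _)
  · have hp0 : (p : ℚ) ≠ 0 := by exact_mod_cast (Fact.out : p.Prime).ne_zero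
    have h₁ : (∑ a ∈ range p, (a : ℚ) ^ m) / p = ∑ e ∈ range (m + 1),
        (bernoulli (m - e) * ((m + 1).choose (m - e)) / (m + 1 : ℕ)) * (p : ℚ) ^ e := by
      rw [hF, sum_div]
      refine sum_congr rfl fun e _ => ?_
      field_simp
      ring
    have h₂ : ReducesTo p ((∑ a ∈ range p, (a : ℚ) ^ m) / p)
        (∑ e ∈ range (m + 1), ρ e * (p : ZMod p) ^ e) := by
      rw [h₁]
      exact ReducesTo.sum fun e he =>
        (hρ e (mem_range.mp he)).mul ((ReducesTo.natCast p).pow _)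
    convert h₂ using 1
    rw [sum_range_succ']
    simp [h0]

end Bernoulli

section Binomial

/-- `∑ (-1)^k C(m+1,k) C(m+k,k) = 0`. -/
theorem sum_neg_one_pow_mul_choose_mul_choose (m N : ℕ) (hN : m + 1 < N) :
    ∑ k ∈ range N, (-1 : ℤ) ^ k * ((m + 1).choose k * (m + k).choose k) = 0 := by
  have h : ∀ N : ℕ, ((m : ℤ) + 1) ^ 2 *
      ∑ k ∈ range N, (-1 : ℤ) ^ k * ((m + 1).choose k * (m + k).choose k) =
      -(N ^ 2 * ((-1 : ℤ) ^ N * ((m + 1).choose N * (m + N).choose N))) := by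
    intro N
    induction N with
    | zero => simp
    | succ k ih =>
      rw [sum_range_succ, mul_add, ih]
      have h₁ : ((m + 1).choose (k + 1) : ℤ) * (k + 1) = (m + 1).choose k * (m + 1 - k) := by
        rcases le_or_gt k (m + 1) with hk | hk
        · have := congrArg (Nat.cast : ℕ → ℤ) (Nat.choose_succ_right_eq (m + 1) k)
          push_cast [Nat.cast_sub hk] at this
          exact this
        · simp [Nat.choose_eq_zero_of_lt hk, Nat.choose_eq_zero_of_lt (hk.trans k.lt_succ_self)]
      have h₂ : ((m + (k + 1)).choose (k + 1) : ℤ) * (k + 1) = (m + k + 1) * (m + k).choose k := by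
        exact_mod_cast (Nat.add_one_mul_choose_eq (m + k) k).symm
      push_cast
      rw [pow_succ (-1 : ℤ) k]
      linear_combination (-1 : ℤ) ^ k * (-((m + (k + 1)).choose (k + 1) : ℤ) * (k + 1) * h₁ -
        ((m + 1).choose k : ℤ) * (m + 1 - k) * h₂)
  have := h N
  rw [Nat.choose_eq_zero_of_lt hN] at this
  simp only [Nat.cast_zero, zero_mul, mul_zero, neg_zero] at this
  exact (mul_eq_zero.mp this).resolve_left (by positivity)

/-- The coefficients `(-1)^k C(m,k) C(m+k,k)` of the shifted Legendre polynomial. -/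
def legendreCoeff (m k : ℕ) : ℤ := (-1) ^ k * (m.choose k * (m + k).choose k)

theorem legendreCoeff_mul (m k : ℕ) : (m + 1) * legendreCoeff m k =
    (m + 1 - k) * ((-1) ^ k * ((m + 1).choose k * (m + k).choose k)) := by
  have h₁ : (m.choose k : ℤ) * (m + 1) = (m + 1).choose k * (m + 1 - k) := by
    rcases le_or_gt k (m + 1) with hk | hk
    · have := congrArg (Nat.cast : ℕ → ℤ) (Nat.choose_mul_succ_eq m k)
      push_cast [Nat.cast_sub hk] at this
      exact this
    · simp [Nat.choose_eq_zero_of_lt hk, Nat.choose_eq_zero_of_lt (show m < k by omega)]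
  rw [legendreCoeff]
  linear_combination (-1) ^ k * ((m + k).choose k : ℤ) * h₁

theorem legendreCoeff_succ_mul (m k : ℕ) : (m + 1) * legendreCoeff (m + 1) k =
    (m + 1 + k) * ((-1) ^ k * ((m + 1).choose k * (m + k).choose k)) := by
  have h₁ : ((m + k).choose k : ℤ) * (m + k + 1) = (m + 1 + k).choose k * (m + 1) := by
    have := Nat.choose_mul_succ_eq (m + k) k
    rw [show m + k + 1 - k = m + 1 by omega, show m + k + 1 = m + 1 + k by omega] at this
    have := congrArg (Nat.cast : ℕ → ℤ) this
    push_cast at this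
    linear_combination this
  rw [legendreCoeff]
  linear_combination -(-1) ^ k * ((m + 1).choose k : ℤ) * h₁

theorem succ_sq_mul_legendreCoeff_succ (m k : ℕ) :
    ((k : ℤ) + 1) ^ 2 * legendreCoeff m (k + 1) = -((m - k) * (m + k + 1)) * legendreCoeff m k := by
  have h₁ : (m.choose (k + 1) : ℤ) * (k + 1) = m.choose k * (m - k) := by
    rcases le_or_gt k m with hk | hk
    · have := congrArg (Nat.cast : ℕ → ℤ) (Nat.choose_succ_right_eq m k)
      push_cast [Nat.cast_sub hk] at this
      exact this
    · simp [Nat.choose_eq_zero_of_lt hk, Nat.choose_eq_zero_of_lt (hk.trans k.lt_succ_self)]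
  have h₂ : ((m + (k + 1)).choose (k + 1) : ℤ) * (k + 1) = (m + k + 1) * (m + k).choose k := by
    exact_mod_cast (Nat.add_one_mul_choose_eq (m + k) k).symm
  rw [legendreCoeff, legendreCoeff, pow_succ (-1 : ℤ) k]
  linear_combination -(-1 : ℤ) ^ k * (((m + (k + 1)).choose (k + 1) : ℤ) * (k + 1) * h₁ +
        (m.choose k : ℤ) * (m - k) * h₂)

variable {K : Type*} [Field K]

theorem sum_legendreCoeff_div_odd (m N : ℕ) (hN : m < N) (hm : ∀ k < N, (2 * k + 1 : K) ≠ 0)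
    (hm' : ∀ k < N, (k + 1 : K) ≠ 0) :
    ∑ k ∈ range N, (legendreCoeff m k : K) / (2 * k + 1) = (2 * m + 1 : K)⁻¹ := by
  induction m with
  | zero =>
    obtain ⟨N, rfl⟩ : ∃ M, N = M + 1 := ⟨N - 1, by omega⟩
    rw [sum_range_succ', sum_eq_zero]
    · simp [legendreCoeff]
    · intro i _
      simp [legendreCoeff]
  | succ m ih =>
    have h₁ := ih (by omega)
    have hm1 := hm m (by omega)
    have hm2 := hm (m + 1) (by omega)
    have hm3 := hm' m (by omega)
    have key : ∀ k ∈ range N,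
        (2 * (m + 1 : ℕ) + 1) * ((legendreCoeff (m + 1) k : K) / (2 * k + 1)) -
        (2 * m + 1) * ((legendreCoeff m k : K) / (2 * k + 1)) =
        2 * (((-1) ^ k * ((m + 1).choose k * (m + k).choose k) : ℤ) : K) := by
      intro k hk
      have hk' := hm k (mem_range.mp hk)
      have e₁ := congrArg (Int.cast : ℤ → K) (legendreCoeff_mul m k)
      have e₂ := congrArg (Int.cast : ℤ → K) (legendreCoeff_succ_mul m k)
      field_simp
      apply mul_left_cancel₀ hm3
      push_cast at e₁ e₂ ⊢
      linear_combination (2 * (m + 1) + 1 : K) * e₂ - (2 * m + 1) * e₁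
    have hs := sum_congr (rfl : range N = range N) key
    rw [sum_sub_distrib, ← mul_sum, ← mul_sum, ← mul_sum, ← Int.cast_sum,
      sum_neg_one_pow_mul_choose_mul_choose m N hN, h₁, mul_inv_cancel₀ hm1] at hs
    apply eq_inv_of_mul_eq_one_left
    simp only [Int.cast_zero, mul_zero] at hs
    linear_combination hs

theorem sum_legendreCoeff_div_succ (m N : ℕ) (hN : m ≤ N) (hm : ∀ k < N, (k + 1 : K) ≠ 0) :
    ∑ k ∈ range N, (legendreCoeff m (k + 1) : K) / (k + 1) =
      -2 * ∑ i ∈ range m, (i + 1 : K)⁻¹ := by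
  induction m with
  | zero => simp [legendreCoeff]
  | succ m ih =>
    have h₁ := ih (by omega)
    have hm3 := hm m (by omega)
    have key : ∀ k ∈ range N, ((legendreCoeff (m + 1) (k + 1) : K) / (k + 1)) -
        ((legendreCoeff m (k + 1) : K) / (k + 1)) =
        2 * (m + 1 : K)⁻¹ * (((-1) ^ (k + 1) *
          ((m + 1).choose (k + 1) * (m + (k + 1)).choose (k + 1)) : ℤ) : K) := by
      intro k hk
      have hk' := hm k (mem_range.mp hk)
      have e₁ := congrArg (Int.cast : ℤ → K) (legendreCoeff_mul m (k + 1))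
      have e₂ := congrArg (Int.cast : ℤ → K) (legendreCoeff_succ_mul m (k + 1))
      field_simp
      push_cast at e₁ e₂ ⊢
      linear_combination e₂ - e₁
    have hs := sum_congr (rfl : range N = range N) key
    have hz := sum_neg_one_pow_mul_choose_mul_choose m (N + 1) (by omega)
    rw [sum_range_succ'] at hz
    have hz' : ∑ k ∈ range N, (-1 : ℤ) ^ (k + 1) *
          ((m + 1).choose (k + 1) * (m + (k + 1)).choose (k + 1)) = -1 := by
      simp only [pow_zero, Nat.choose_zero_right, Nat.cast_one, mul_one] at hz
      linarith
    rw [sum_sub_distrib, ← mul_sum, ← Int.cast_sum, hz', h₁] at hs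
    rw [sum_range_succ]
    push_cast at hs
    linear_combination hs

end Binomial

section PowerSums

theorem sum_zmod_eq_sum_range {p : ℕ} [NeZero p] {M : Type*} [AddCommMonoid M] (φ : ZMod p → M) :
    ∑ x : ZMod p, φ x = ∑ a ∈ range p, φ a := by
  refine sum_nbij' ZMod.val (fun a => (a : ZMod p)) ?_ ?_ ?_ ?_ ?_
  · intro x _
    exact mem_range.mpr x.val_lt
  · simp
  · simp
  · intro a ha
    exact ZMod.val_cast_of_lt (mem_range.mp ha)
  · simp

variable {p n : ℕ} [Fact p.Prime]

theorem sum_pow_mul_inv_pow {e d : ℕ} (hd : 0 < d) (hd' : d < p - 1) (he : e < d + (p - 1)) :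
    ∑ x : ZMod p, x ^ e * x⁻¹ ^ d = if e = d then -1 else 0 := by
  have hlt : ∀ i, i < p - 1 → ∑ x : ZMod p, x ^ i = 0 := fun i hi =>
    FiniteField.sum_pow_lt_card_sub_one _ i (by rwa [ZMod.card])
  rcases lt_trichotomy e d with h | rfl | h
  · rw [if_neg h.ne, ← hlt (e + (p - 1 - d)) (by omega)]
    refine sum_congr rfl fun x _ => ?_
    rcases eq_or_ne x 0 with rfl | hx
    · rw [inv_zero, zero_pow hd.ne', mul_zero, zero_pow (by omega)]
    · rw [pow_add, pow_sub₀ x hx hd'.le, ZMod.pow_card_sub_one_eq_one hx, one_mul, inv_pow]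
  · rw [if_pos rfl]
    have h₁ : ∀ x : ZMod p, x ^ e * x⁻¹ ^ e = 1 - if x = 0 then 1 else 0 := by
      intro x
      rcases eq_or_ne x 0 with rfl | hx
      · simp [hd.ne']
      · rw [if_neg hx, ← mul_pow, mul_inv_cancel₀ hx, one_pow, sub_zero]
    rw [sum_congr rfl fun x _ => h₁ x, sum_sub_distrib]
    simp
  · rw [if_neg h.ne', ← hlt (e - d) (by omega)]
    refine sum_congr rfl fun x _ => ?_
    rcases eq_or_ne x 0 with rfl | hx
    · rw [inv_zero, zero_pow hd.ne', mul_zero, zero_pow (by omega)]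
    · rw [pow_sub₀ x hx h.le, inv_pow]

theorem two_mul_half_add_one (hp : p = 2 * n + 1) : (2 * n + 1 : ZMod p) = 0 := by
  have : ((2 * n + 1 : ℕ) : ZMod p) = 0 := by rw [← hp, ZMod.natCast_self]
  exact_mod_cast this

theorem sum_odd_eq_sum_neg_even (hp : p = 2 * n + 1) {M : Type*} [AddCommMonoid M]
    (φ : ZMod p → M) :
    ∑ m ∈ range n, φ (2 * m + 1) = ∑ j ∈ range n, φ (-(2 * (j + 1))) := by
  rw [← sum_range_reflect]
  refine sum_congr rfl fun j hj => congrArg φ ?_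
  rw [mem_range] at hj
  rw [Nat.sub_sub, Nat.cast_sub (by omega)]
  push_cast
  linear_combination two_mul_half_add_one hp

theorem sum_range_two_mul {M : Type*} [AddCommMonoid M] (f : ℕ → M) (N : ℕ) :
    ∑ a ∈ range (2 * N), f a = ∑ a ∈ range N, f (2 * a) + ∑ a ∈ range N, f (2 * a + 1) := by
  induction N with
  | zero => simp
  | succ N ih =>
    rw [mul_add, mul_one, sum_range_succ, sum_range_succ, ih, sum_range_succ, sum_range_succ]
    abel

theorem sum_zmod_eq_two_mul_sum_odd (hp : p = 2 * n + 1) (φ : ZMod p → ZMod p)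
    (h0 : φ 0 = 0) (hφ : ∀ x, φ (-x) = φ x) :
    ∑ x, φ x = 2 * ∑ m ∈ range n, φ (2 * m + 1) := by
  have h₁ := sum_odd_eq_sum_neg_even hp φ
  simp only [hφ] at h₁
  have h₂ : ∑ x, φ x = ∑ a ∈ range (2 * n + 1), φ a := by
    rw [sum_zmod_eq_sum_range, ← hp]
  rw [h₂, sum_range_succ', sum_range_two_mul (fun a => φ ((a + 1 : ℕ) : ZMod p))]
  push_cast
  rw [h0, two_mul (∑ m ∈ range n, φ (2 * m + 1))]
  nth_rw 3 [h₁]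
  rw [add_zero]
  congr 1
  exact sum_congr rfl fun m _ => congrArg φ (by ring)

theorem sum_odd_sq_pow_mul_inv_sq (hp : p = 2 * n + 1) (hn : 2 ≤ n) {e : ℕ} (he : e ≤ n) :
    ∑ m ∈ range n, ((2 * m + 1 : ZMod p) ^ 2) ^ e * (2 * m + 1 : ZMod p)⁻¹ ^ 2 =
      if e = 1 then (n : ZMod p) else 0 := by
  have h2 : (2 : ZMod p) ≠ 0 := by
    exact_mod_cast natCast_zmod_ne_zero (p := p) (k := 2) (by omega) (by omega)
  have h₁ := sum_zmod_eq_two_mul_sum_odd hp (fun x => (x ^ 2) ^ e * x⁻¹ ^ 2) (by simp)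
    (fun x => by rw [neg_sq, inv_neg, neg_sq])
  simp only [← pow_mul] at h₁ ⊢
  rw [sum_pow_mul_inv_pow (by omega) (by omega) (by omega)] at h₁
  apply mul_left_cancel₀ h2
  rw [← h₁]
  by_cases h : e = 1
  · rw [if_pos (by omega), if_pos h]
    linear_combination -two_mul_half_add_one hp
  · rw [if_neg (by omega), if_neg h, mul_zero]

/-- Extraction of the linear coefficient of a polynomial from its values at nonzero squares. -/
theorem sum_eval_odd_sq_mul_inv_sq (hp : p = 2 * n + 1) (hn : 2 ≤ n) (Q : Polynomial (ZMod p))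
    (hQ : Q.natDegree ≤ n) :
    ∑ m ∈ range n, Q.eval ((2 * m + 1 : ZMod p) ^ 2) * (2 * m + 1 : ZMod p)⁻¹ ^ 2 =
      n * Q.coeff 1 := by
  have h : ∀ x, Q.eval x = ∑ e ∈ range (n + 1), Q.coeff e * x ^ e := fun x =>
    Polynomial.eval_eq_sum_range' (by omega) x
  simp only [h, sum_mul]
  rw [sum_comm]
  have h' : ∀ e ∈ range (n + 1), ∑ m ∈ range n,
      Q.coeff e * ((2 * m + 1 : ZMod p) ^ 2) ^ e * (2 * m + 1 : ZMod p)⁻¹ ^ 2 =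
      if e = 1 then n * Q.coeff 1 else 0 := by
    intro e he
    simp only [mul_assoc]
    rw [← mul_sum, sum_odd_sq_pow_mul_inv_sq hp hn (by simpa [Nat.lt_succ_iff] using he)]
    split_ifs with h
    · rw [h, mul_comm]
    · rw [mul_zero]
  rw [sum_congr rfl h', sum_ite_eq' (range (n + 1)) 1 fun _ => (n : ZMod p) * Q.coeff 1,
    if_pos (by simp; omega)]

end PowerSums

section HarmonicSums

variable {p n : ℕ} [Fact p.Prime]

theorem sum_range_pow_odd {R : Type*} [CommRing R] (m i : ℕ) :
    ∑ a ∈ range i, (2 * a + 1 : R) ^ m =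
      ∑ a ∈ range (2 * i), (a : R) ^ m - 2 ^ m * ∑ a ∈ range i, (a : R) ^ m := by
  rw [sum_range_two_mul (fun a => (a : R) ^ m), mul_sum]
  push_cast
  simp only [mul_pow]
  ring

theorem sum_by_parts_inv {K : Type*} [Field K] (c : ℕ → K) (N : ℕ) :
    ∑ a ∈ range N, (∑ i ∈ range a, (i + 1 : K)⁻¹) * c a =
      (∑ i ∈ range N, (i + 1 : K)⁻¹) * ∑ b ∈ range N, c b -
        ∑ i ∈ range N, (i + 1 : K)⁻¹ * ∑ b ∈ range (i + 1), c b := by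
  induction N with
  | zero => simp
  | succ N ih =>
    rw [sum_range_succ, ih, sum_range_succ _ N, sum_range_succ _ N, sum_range_succ _ N,
      sum_range_succ c N]
    ring

theorem harmonic_zmod_reflect (hp : p = 2 * n + 1) (hn : 2 ≤ n) (a : ℕ) (ha : a ≤ 2 * n) :
    ∑ i ∈ range (2 * n - a), (i + 1 : ZMod p)⁻¹ = ∑ i ∈ range a, (i + 1 : ZMod p)⁻¹ := by
  induction a with
  | zero =>
    have h := sum_pow_mul_inv_pow (p := p) (e := 0) (d := 1) (by omega) (by omega) (by omega)
    have h₂ : ∑ x : ZMod p, x⁻¹ = ∑ a ∈ range (2 * n + 1), (a : ZMod p)⁻¹ := by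
      rw [sum_zmod_eq_sum_range, ← hp]
    simp only [pow_zero, pow_one, one_mul] at h
    rw [h₂, sum_range_succ'] at h
    simpa using h
  | succ a ih =>
    have h := ih (by omega)
    rw [show 2 * n - a = 2 * n - (a + 1) + 1 by omega, sum_range_succ] at h
    rw [sum_range_succ, ← h, Nat.cast_sub ha]
    push_cast
    rw [show (2 * n - (a + 1) + 1 : ZMod p) = -(a + 1) by
      linear_combination two_mul_half_add_one hp, inv_neg]
    ring

theorem zmod_inv_sq_eq_pow (hp : 3 < p) (x : ZMod p) : x⁻¹ ^ 2 = x ^ (p - 3) := by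
  rcases eq_or_ne x 0 with rfl | hx
  · rw [inv_zero, zero_pow (by omega), zero_pow (by omega)]
  · rw [show p - 3 = p - 1 - 2 by omega, pow_sub₀ x hx (by omega),
      ZMod.pow_card_sub_one_eq_one hx, one_mul, inv_pow]

theorem two_pow_sub_three (hp : 3 < p) : (4 : ZMod p) * 2 ^ (p - 3) = 1 := by
  have h2 : (2 : ZMod p) ≠ 0 := by
    exact_mod_cast natCast_zmod_ne_zero (p := p) (k := 2) (by omega) (by omega)
  rw [← ZMod.pow_card_sub_one_eq_one h2, show p - 1 = p - 3 + 2 by omega, pow_add]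
  ring

theorem sum_harmonic_mul_inv_odd_sq (hp : p = 2 * n + 1) (hn : 2 ≤ n) {b : ZMod p}
    (hb : ReducesTo p (bernoulli (p - 3)) b) :
    8 * ∑ m ∈ range n, (∑ i ∈ range m, (i + 1 : ZMod p)⁻¹) * (2 * m + 1 : ZMod p)⁻¹ ^ 2 =
      7 * b := by
  set c : ℕ → ZMod p := fun m => (2 * m + 1 : ZMod p) ^ (p - 3) with hc
  have hcinv : ∀ m : ℕ, (2 * m + 1 : ZMod p)⁻¹ ^ 2 = c m := fun m =>
    zmod_inv_sq_eq_pow (by omega) _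
  simp only [hcinv]
  set φ : ℕ → ZMod p := fun m => (∑ i ∈ range m, (i + 1 : ZMod p)⁻¹) * c m with hφ
  have hcn : c n = 0 := by
    simp only [hc]
    rw [two_mul_half_add_one hp, zero_pow (by omega)]
  have hp' : ∑ a ∈ range p, φ a = 2 * ∑ m ∈ range n, φ m := by
    have : ∑ m ∈ range n, φ (n + 1 + m) = ∑ m ∈ range n, φ m := by
      rw [← sum_range_reflect]
      refine sum_congr rfl fun j hj => ?_
      rw [mem_range] at hj
      rw [show n + 1 + (n - 1 - j) = 2 * n - j by omega]
      simp only [hφ]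
      rw [harmonic_zmod_reflect hp hn j (by omega), ← hcinv, ← hcinv, Nat.cast_sub (by omega)]
      push_cast
      rw [show (2 * (2 * n - j) + 1 : ZMod p) = -(2 * j + 1) by
        linear_combination 2 * two_mul_half_add_one hp, inv_neg, neg_sq]
    have hsplit : ∑ a ∈ range p, φ a = ∑ a ∈ range (n + 1 + n), φ a :=
      congrArg (fun N => ∑ a ∈ range N, φ a) (by omega)
    have hφn : φ n = 0 := by simp only [hφ, hcn, mul_zero]
    rw [hsplit, sum_range_add, sum_range_succ, this, hφn]
    ring
  obtain ⟨ρ, hρ0, hρ, -⟩ := exists_sum_range_pow_eq (p - 3) (by omega) hb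
  have hs : ∀ i : ℕ, ∑ a ∈ range i, c a = ∑ e ∈ range (p - 3 + 1),
      ρ e * (2 ^ (e + 1) - 2 ^ (p - 3)) * (i : ZMod p) ^ (e + 1) := by
    intro i
    rw [sum_range_pow_odd, hρ, hρ, mul_sum, ← sum_sub_distrib]
    refine sum_congr rfl fun e _ => ?_
    push_cast
    ring
  have hsp : ∑ a ∈ range p, c a = 0 := by
    rw [hs]
    simp
  have hparts := sum_by_parts_inv c p
  rw [hsp, mul_zero, zero_sub] at hparts
  have hx : ∑ i ∈ range p, (i + 1 : ZMod p)⁻¹ * ∑ b ∈ range (i + 1), c b =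
      ∑ x : ZMod p, ∑ e ∈ range (p - 3 + 1),
        ρ e * (2 ^ (e + 1) - 2 ^ (p - 3)) * (x ^ (e + 1) * x⁻¹ ^ 1) := by
    rw [← Equiv.sum_comp (Equiv.addRight (1 : ZMod p)), sum_zmod_eq_sum_range]
    refine sum_congr rfl fun i _ => ?_
    rw [hs, mul_sum]
    refine sum_congr rfl fun e _ => ?_
    rw [Equiv.coe_addRight]
    push_cast
    ring
  rw [sum_comm] at hx
  simp only [← mul_sum] at hx
  have hx' : ∀ e ∈ range (p - 3 + 1), ρ e * (2 ^ (e + 1) - 2 ^ (p - 3)) *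
      ∑ x : ZMod p, x ^ (e + 1) * x⁻¹ ^ 1 = if e = 0 then -(b * (2 - 2 ^ (p - 3))) else 0 := by
    intro e he
    rw [mem_range] at he
    rw [sum_pow_mul_inv_pow (by omega) (by omega) (by omega)]
    by_cases h : e = 0
    · simp [h, hρ0]
    · simp [h]
  rw [sum_congr rfl hx', sum_ite_eq', if_pos (by simp)] at hx
  rw [hx] at hparts
  have h2 := two_pow_sub_three (p := p) (by omega)
  linear_combination -4 * hp' + 4 * hparts - b * h2

theorem add_pow_of_sq_eq_zero {R : Type*} [CommRing R] {x : R} (hx : x * x = 0) (y : R) (k : ℕ) :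
    (y + x) ^ (k + 1) = y ^ (k + 1) + (k + 1) * y ^ k * x := by
  induction k with
  | zero => simp
  | succ k ih =>
    rw [pow_succ, ih]
    push_cast
    linear_combination (k + 1) * y ^ k * hx

theorem sum_inv_cube_half (hp : p = 2 * n + 1) (hn : 2 ≤ n) {b : ZMod p}
    (hb : ReducesTo p (bernoulli (p - 3)) b) :
    ∑ j ∈ range n, (j + 1 : ZMod p)⁻¹ ^ 3 = -2 * b := by
  obtain ⟨l, rfl⟩ : ∃ l, n = l + 2 := ⟨n - 2, by omega⟩
  have hm : p - 3 = 2 * l + 1 + 1 := by omega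
  obtain ⟨-, -, -, hP⟩ := exists_sum_range_pow_eq (p - 3) (by omega) hb
  rw [hm] at hP
  obtain ⟨P, hPdef⟩ : ∃ P : ℕ, P = ∑ a ∈ range p, a ^ (2 * l + 1 + 1) := ⟨_, rfl⟩
  obtain ⟨J, hJ⟩ : ∃ J : ℕ, J = ∑ j ∈ range (l + 2), (j + 1) ^ (2 * l + 1 + 1) := ⟨_, rfl⟩
  obtain ⟨T, hT⟩ : ∃ T : ℕ, T = ∑ j ∈ range (l + 2), (j + 1) ^ (2 * l + 1) := ⟨_, rfl⟩
  have hε : (p : ZMod (p ^ 2)) * p = 0 := by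
    have : ((p ^ 2 : ℕ) : ZMod (p ^ 2)) = 0 := ZMod.natCast_self _
    rw [← this]
    push_cast
    ring
  have hodd : Odd (2 * l + 1) := ⟨l, rfl⟩
  have hsub : ∀ y : ZMod (p ^ 2), ((p : ZMod (p ^ 2)) - y) ^ (2 * l + 1 + 1) =
      y ^ (2 * l + 1 + 1) -
        (2 * (l : ZMod (p ^ 2)) + 2) * y ^ (2 * l + 1) * (p : ZMod (p ^ 2)) := by
    intro y
    have := add_pow_of_sq_eq_zero hε (-y) (2 * l + 1)
    rw [hodd.neg_pow, hodd.add_one.neg_pow] at this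
    push_cast at this
    linear_combination this
  have hP₁ : (P : ZMod (p ^ 2)) = 2 * J - (2 * l + 2) * p * T := by
    have h : P = ∑ j ∈ range (l + 2), (j + 1) ^ (2 * l + 1 + 1) +
        ∑ j ∈ range (l + 2), (p - (j + 1)) ^ (2 * l + 1 + 1) := by
      have : ∑ j ∈ range (l + 2), (p - (j + 1)) ^ (2 * l + 1 + 1) =
          ∑ j ∈ range (l + 2), (l + 2 + j + 1) ^ (2 * l + 1 + 1) := by
        rw [← sum_range_reflect]
        refine sum_congr rfl fun j hj => ?_
        rw [mem_range] at hj
        congr 1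
        omega
      rw [this, hPdef, hp, sum_range_succ', two_mul, sum_range_add]
      simp
    have h' : ∀ j ∈ range (l + 2), (((p - (j + 1)) ^ (2 * l + 1 + 1) : ℕ) : ZMod (p ^ 2)) =
        (j + 1) ^ (2 * l + 1 + 1) - (2 * l + 2) * (j + 1) ^ (2 * l + 1) * p := by
      intro j hj
      rw [mem_range] at hj
      rw [← hsub]
      push_cast [Nat.cast_sub (show j + 1 ≤ p by omega)]
      ring
    rw [h, Nat.cast_add, Nat.cast_sum, Nat.cast_sum, sum_congr rfl h', sum_sub_distrib, hJ, hT,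
      ← sum_mul, ← mul_sum]
    push_cast
    ring
  have hP₂ : (P : ZMod (p ^ 2)) = 2 * 2 ^ (2 * l + 2) * J -
      (2 * l + 2) * 2 ^ (2 * l + 1) * p * T := by
    have h : P = ∑ j ∈ range (l + 2), (2 * (j + 1)) ^ (2 * l + 1 + 1) +
        ∑ j ∈ range (l + 2), (p - 2 * (j + 1)) ^ (2 * l + 1 + 1) := by
      have : ∑ j ∈ range (l + 2), (p - 2 * (j + 1)) ^ (2 * l + 1 + 1) =
          ∑ j ∈ range (l + 2), (2 * j + 1) ^ (2 * l + 1 + 1) := by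
        rw [← sum_range_reflect]
        refine sum_congr rfl fun j hj => ?_
        rw [mem_range] at hj
        congr 1
        omega
      rw [this, hPdef, hp, sum_range_succ',
        sum_range_two_mul (fun a => (a + 1) ^ (2 * l + 1 + 1)), zero_pow (by omega), add_zero,
        add_comm]
      rfl
    have h' : ∀ j ∈ range (l + 2), (((p - 2 * (j + 1)) ^ (2 * l + 1 + 1) : ℕ) : ZMod (p ^ 2)) =
        2 ^ (2 * l + 2) * (j + 1) ^ (2 * l + 1 + 1) -
          (2 * l + 2) * 2 ^ (2 * l + 1) * p * (j + 1) ^ (2 * l + 1) := by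
      intro j hj
      rw [mem_range] at hj
      push_cast [Nat.cast_sub (show 2 * (j + 1) ≤ p by omega)]
      rw [hsub]
      simp only [mul_pow]
      ring
    rw [h, Nat.cast_add, Nat.cast_sum, Nat.cast_sum, sum_congr rfl h', sum_sub_distrib, hJ, hT,
      ← mul_sum, ← mul_sum]
    push_cast
    simp only [mul_pow, ← mul_sum]
    ring
  have hz : (((2 ^ (2 * l + 2) - 1) * P + (2 * l + 2) * 2 ^ (2 * l + 1) * p * T : ℤ) :
      ZMod (p ^ 2)) = 0 := by
    push_cast
    linear_combination 2 ^ (2 * l + 2) * hP₁ - hP₂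
  rw [ZMod.intCast_zmod_eq_zero_iff_dvd] at hz
  obtain ⟨c, hc⟩ := hz
  have hp0 : (p : ℚ) ≠ 0 := by exact_mod_cast (Fact.out : p.Prime).ne_zero
  have hq : ((2 ^ (2 * l + 2) - 1 : ℤ) : ℚ) * ((∑ a ∈ range p, (a : ℚ) ^ (2 * l + 1 + 1)) / p) +
      (((2 * l + 2) * 2 ^ (2 * l + 1) * T : ℕ) : ℚ) = ((p * c : ℤ) : ℚ) := by
    have hc' := congrArg (Int.cast : ℤ → ℚ) hc
    have hPQ : ∑ a ∈ range p, (a : ℚ) ^ (2 * l + 1 + 1) = P := by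
      rw [hPdef]
      push_cast
      rfl
    rw [hPQ]
    push_cast at hc' ⊢
    field_simp
    linear_combination hc'
  have hred := ((ReducesTo.intCast (p := p) (2 ^ (2 * l + 2) - 1)).mul hP).add
    (ReducesTo.natCast ((2 * l + 2) * 2 ^ (2 * l + 1) * T))
  rw [hq] at hred
  have hfin := hred.unique (ReducesTo.intCast _)
  push_cast at hfin
  rw [ZMod.natCast_self, zero_mul] at hfin
  have hT' : (T : ZMod p) = ∑ j ∈ range (l + 2), (j + 1 : ZMod p)⁻¹ ^ 3 := by
    rw [hT]
    push_cast
    refine sum_congr rfl fun j hj => ?_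
    rw [mem_range] at hj
    have hj0 : (j + 1 : ZMod p) ≠ 0 := by
      exact_mod_cast natCast_zmod_ne_zero (p := p) (k := j + 1) (by omega) (by omega)
    rw [show 2 * l + 1 = p - 1 - 3 by omega, pow_sub₀ _ hj0 (by omega),
      ZMod.pow_card_sub_one_eq_one hj0, one_mul, inv_pow]
  have hl : (2 * l + 2 : ZMod p) = -3 := by
    have := two_mul_half_add_one hp
    push_cast at this
    linear_combination this
  have h4 := two_pow_sub_three (p := p) (by omega)
  rw [show p - 3 = 2 * l + 1 + 1 by omega] at h4
  rw [← hT']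
  rw [hl] at hfin
  have h3 : (3 : ZMod p) ≠ 0 := by
    exact_mod_cast natCast_zmod_ne_zero (p := p) (k := 3) (by omega) (by omega)
  apply mul_left_cancel₀ h3
  rw [show 2 * l + 2 = 2 * l + 1 + 1 by rfl] at hfin
  linear_combination -8 * hfin + (2 * b - 3 * T) * h4

end HarmonicSums

section LegendrePolynomial

open scoped Polynomial

/-- The polynomial `∏_{j ≤ k} ((2j-1)² - X) / (2j)²`. -/
noncomputable def oddSquareProd (K : Type*) [Field K] (k : ℕ) : K[X] :=
  ∏ j ∈ range k, Polynomial.C ((2 * (j + 1) : K)⁻¹ ^ 2) *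
    (Polynomial.C ((2 * j + 1 : K) ^ 2) - Polynomial.X)

theorem natDegree_oddSquareProd_le (K : Type*) [Field K] (k : ℕ) :
    (oddSquareProd K k).natDegree ≤ k := by
  refine (Polynomial.natDegree_prod_le _ _).trans ?_
  refine (sum_le_card_nsmul _ _ 1 fun j _ => ?_).trans (by simp)
  compute_degree

theorem eval_oddSquareProd {K : Type*} [Field K] (m : ℕ) {k : ℕ}
    (hk : ∀ j < k, (2 * (j + 1) : K) ≠ 0) :
    (oddSquareProd K k).eval ((2 * m + 1 : K) ^ 2) = legendreCoeff m k := by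
  induction k with
  | zero => simp [oddSquareProd, legendreCoeff]
  | succ k ih =>
    have hk0 := hk k (by omega)
    have e := congrArg (Int.cast : ℤ → K) (succ_sq_mul_legendreCoeff_succ m k)
    push_cast at e
    rw [oddSquareProd, prod_range_succ, ← oddSquareProd, Polynomial.eval_mul,
      ih fun j hj => hk j (by omega)]
    simp only [Polynomial.eval_mul, Polynomial.eval_C, Polynomial.eval_sub, Polynomial.eval_X]
    have hinv : (2 * (k + 1) : K) ^ 2 * (2 * (k + 1) : K)⁻¹ ^ 2 = 1 := by
      rw [← mul_pow, mul_inv_cancel₀ hk0, one_pow]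
    apply mul_left_cancel₀ (pow_ne_zero 2 hk0)
    linear_combination (legendreCoeff m k : K) * ((2 * k + 1) ^ 2 - (2 * m + 1) ^ 2) * hinv - 4 * e

variable {p n : ℕ} [Fact p.Prime]

theorem two_mul_succ_mul_choose_succ (hp : p = 2 * n + 1) (k : ℕ) :
    (2 * (k + 1) : ZMod p) * n.choose (k + 1) = -(2 * k + 1) * n.choose k := by
  rcases le_or_gt k n with hk | hk
  · have := congrArg (Nat.cast : ℕ → ZMod p) (Nat.choose_succ_right_eq n k)
    push_cast [Nat.cast_sub hk] at this
    linear_combination 2 * this + (n.choose k : ZMod p) * two_mul_half_add_one hp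
  · simp [Nat.choose_eq_zero_of_lt hk, Nat.choose_eq_zero_of_lt (hk.trans k.lt_succ_self)]

theorem two_mul_succ_zmod_ne_zero (hp : p = 2 * n + 1) {j : ℕ} (hj : j < n) :
    (2 * (j + 1) : ZMod p) ≠ 0 := by
  exact_mod_cast natCast_zmod_ne_zero (p := p) (k := 2 * (j + 1)) (by omega) (by omega)

theorem two_mul_add_one_zmod_ne_zero (hp : p = 2 * n + 1) {j : ℕ} (hj : j < n) :
    (2 * j + 1 : ZMod p) ≠ 0 := by
  exact_mod_cast natCast_zmod_ne_zero (p := p) (k := 2 * j + 1) (by omega) (by omega)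

theorem centralBinom_zmod (hp : p = 2 * n + 1) {k : ℕ} (hk : k ≤ n) :
    ((2 * k).choose k : ZMod p) = (-4) ^ k * n.choose k := by
  induction k with
  | zero => simp
  | succ k ih =>
    have h₁ := congrArg (Nat.cast : ℕ → ZMod p) (Nat.succ_mul_centralBinom_succ k)
    rw [Nat.centralBinom_eq_two_mul_choose, Nat.centralBinom_eq_two_mul_choose] at h₁
    push_cast at h₁
    rw [ih (by omega)] at h₁
    apply mul_left_cancel₀ (two_mul_succ_zmod_ne_zero hp (j := k) (by omega))
    rw [pow_succ]
    linear_combination 2 * h₁ + 4 * (-4) ^ k * two_mul_succ_mul_choose_succ hp k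

theorem coeff_oddSquareProd (hp : p = 2 * n + 1) {k : ℕ} (hk : k ≤ n) :
    (oddSquareProd (ZMod p) k).coeff 0 = (n.choose k : ZMod p) ^ 2 ∧
    (oddSquareProd (ZMod p) k).coeff 1 =
      -((n.choose k : ZMod p) ^ 2 * ∑ j ∈ range k, (2 * j + 1 : ZMod p)⁻¹ ^ 2) := by
  induction k with
  | zero => simp [oddSquareProd, Polynomial.coeff_one]
  | succ k ih =>
    obtain ⟨h0, h1⟩ := ih (by omega)
    have e := two_mul_succ_mul_choose_succ hp k
    have hk0 := two_mul_succ_zmod_ne_zero hp (j := k) (by omega)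
    have hk1 := two_mul_add_one_zmod_ne_zero hp (j := k) (by omega)
    have e' : (n.choose (k + 1) : ZMod p) = (2 * (k + 1) : ZMod p)⁻¹ *
        (-(2 * k + 1) * n.choose k) := by
      rw [← e, inv_mul_cancel_left₀ hk0]
    have hrec : oddSquareProd (ZMod p) (k + 1) =
        Polynomial.C ((2 * (k + 1) : ZMod p)⁻¹ ^ 2) *
          (oddSquareProd (ZMod p) k * Polynomial.C ((2 * k + 1 : ZMod p) ^ 2) -
            oddSquareProd (ZMod p) k * Polynomial.X) := by
      rw [oddSquareProd, prod_range_succ, ← oddSquareProd]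
      ring
    rw [hrec, e', sum_range_succ]
    constructor
    · rw [Polynomial.coeff_C_mul, Polynomial.coeff_sub, Polynomial.coeff_mul_C,
        Polynomial.coeff_mul_X_zero, h0]
      ring
    · rw [Polynomial.coeff_C_mul, Polynomial.coeff_sub, Polynomial.coeff_mul_C,
        Polynomial.coeff_mul_X, h0, h1]
      field_simp
      ring

theorem sum_choose_sq_mul_div_odd (hp : p = 2 * n + 1) (hn : 2 ≤ n) {b : ZMod p}
    (hb : ReducesTo p (bernoulli (p - 3)) b) :
    2 * ∑ k ∈ range n, (n.choose k : ZMod p) ^ 2 / (2 * k + 1) *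
      ∑ j ∈ range k, (2 * j + 1 : ZMod p)⁻¹ ^ 2 = b := by
  have hcoeff := sum_eval_odd_sq_mul_inv_sq hp hn
    (∑ k ∈ range n, Polynomial.C (2 * k + 1 : ZMod p)⁻¹ * oddSquareProd (ZMod p) k) (by
      refine Polynomial.natDegree_sum_le_of_forall_le _ _ fun k hk => ?_
      refine (Polynomial.natDegree_C_mul_le _ _).trans ((natDegree_oddSquareProd_le _ k).trans ?_)
      exact (mem_range.mp hk).le)
  have heval : ∀ m ∈ range n, (∑ k ∈ range n, Polynomial.C (2 * k + 1 : ZMod p)⁻¹ *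
      oddSquareProd (ZMod p) k).eval ((2 * m + 1 : ZMod p) ^ 2) * (2 * m + 1 : ZMod p)⁻¹ ^ 2 =
      (2 * m + 1 : ZMod p)⁻¹ ^ 3 := by
    intro m hm
    rw [Polynomial.eval_finsetSum, pow_succ' _ 2]
    congr 1
    rw [← sum_legendreCoeff_div_odd m n (mem_range.mp hm)
      (fun k hk => two_mul_add_one_zmod_ne_zero hp hk)
      (fun k hk => right_ne_zero_of_mul (two_mul_succ_zmod_ne_zero hp hk))]
    refine sum_congr rfl fun k hk => ?_
    rw [mem_range] at hk
    rw [Polynomial.eval_mul, Polynomial.eval_C,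
      eval_oddSquareProd m fun j hj => two_mul_succ_zmod_ne_zero hp (by omega)]
    ring
  have hc1 : (∑ k ∈ range n, Polynomial.C (2 * k + 1 : ZMod p)⁻¹ *
      oddSquareProd (ZMod p) k).coeff 1 = -∑ k ∈ range n, (n.choose k : ZMod p) ^ 2 / (2 * k + 1) *
      ∑ j ∈ range k, (2 * j + 1 : ZMod p)⁻¹ ^ 2 := by
    rw [Polynomial.finsetSum_coeff, ← sum_neg_distrib]
    refine sum_congr rfl fun k hk => ?_
    rw [Polynomial.coeff_C_mul, (coeff_oddSquareProd hp (mem_range.mp hk).le).2]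
    ring
  rw [sum_congr rfl heval, hc1, sum_odd_eq_sum_neg_even hp (fun x => x⁻¹ ^ 3)] at hcoeff
  have hcube : ∑ j ∈ range n, (-(2 * (j + 1)) : ZMod p)⁻¹ ^ 3 =
      -(2⁻¹ ^ 3 * ∑ j ∈ range n, (j + 1 : ZMod p)⁻¹ ^ 3) := by
    rw [mul_sum, ← sum_neg_distrib]
    refine sum_congr rfl fun j _ => ?_
    rw [inv_neg, mul_inv]
    ring
  have h2 : (2 : ZMod p) ≠ 0 :=
    left_ne_zero_of_mul (two_mul_succ_zmod_ne_zero hp (j := 0) (by omega))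
  have h8 : (2 : ZMod p)⁻¹ ^ 3 * 8 = 1 := by
    field_simp
    norm_num
  rw [hcube, sum_inv_cube_half hp hn hb] at hcoeff
  apply mul_left_cancel₀ h2
  generalize ∑ k ∈ range n, (n.choose k : ZMod p) ^ 2 / (2 * k + 1) *
    ∑ j ∈ range k, (2 * j + 1 : ZMod p)⁻¹ ^ 2 = S at hcoeff ⊢
  linear_combination -8 * hcoeff + 4 * S * two_mul_half_add_one hp + 2 * b * h8

theorem sum_choose_sq_mul_div_succ (hp : p = 2 * n + 1) (hn : 2 ≤ n) {b : ZMod p}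
    (hb : ReducesTo p (bernoulli (p - 3)) b) :
    2 * ∑ k ∈ range n, (n.choose (k + 1) : ZMod p) ^ 2 / (k + 1) *
      ∑ j ∈ range (k + 1), (2 * j + 1 : ZMod p)⁻¹ ^ 2 = -7 * b := by
  have hcoeff := sum_eval_odd_sq_mul_inv_sq hp hn
    (∑ k ∈ range n, Polynomial.C (k + 1 : ZMod p)⁻¹ * oddSquareProd (ZMod p) (k + 1)) (by
      refine Polynomial.natDegree_sum_le_of_forall_le _ _ fun k hk => ?_
      refine (Polynomial.natDegree_C_mul_le _ _).trans ((natDegree_oddSquareProd_le _ _).trans ?_)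
      exact mem_range.mp hk)
  have heval : ∀ m ∈ range n, (∑ k ∈ range n, Polynomial.C (k + 1 : ZMod p)⁻¹ *
      oddSquareProd (ZMod p) (k + 1)).eval ((2 * m + 1 : ZMod p) ^ 2) *
        (2 * m + 1 : ZMod p)⁻¹ ^ 2 =
      -2 * ((∑ i ∈ range m, (i + 1 : ZMod p)⁻¹) * (2 * m + 1 : ZMod p)⁻¹ ^ 2) := by
    intro m hm
    rw [Polynomial.eval_finsetSum, ← mul_assoc]
    congr 1
    rw [← sum_legendreCoeff_div_succ m n (mem_range.mp hm).le
      (fun k hk => right_ne_zero_of_mul (two_mul_succ_zmod_ne_zero hp hk))]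
    refine sum_congr rfl fun k hk => ?_
    rw [mem_range] at hk
    rw [Polynomial.eval_mul, Polynomial.eval_C,
      eval_oddSquareProd m fun j hj => two_mul_succ_zmod_ne_zero hp (by omega)]
    ring
  have hc1 : (∑ k ∈ range n, Polynomial.C (k + 1 : ZMod p)⁻¹ *
      oddSquareProd (ZMod p) (k + 1)).coeff 1 =
      -∑ k ∈ range n, (n.choose (k + 1) : ZMod p) ^ 2 / (k + 1) *
        ∑ j ∈ range (k + 1), (2 * j + 1 : ZMod p)⁻¹ ^ 2 := by
    rw [Polynomial.finsetSum_coeff, ← sum_neg_distrib]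
    refine sum_congr rfl fun k hk => ?_
    rw [Polynomial.coeff_C_mul, (coeff_oddSquareProd hp (mem_range.mp hk)).2]
    ring
  rw [sum_congr rfl heval, hc1, ← mul_sum] at hcoeff
  have hA := sum_harmonic_mul_inv_odd_sq hp hn hb
  have hn2 := two_mul_half_add_one hp
  generalize ∑ k ∈ range n, (n.choose (k + 1) : ZMod p) ^ 2 / (k + 1) *
    ∑ j ∈ range (k + 1), (2 * j + 1 : ZMod p)⁻¹ ^ 2 = S at hcoeff ⊢
  linear_combination -4 * hcoeff - hA + 2 * S * hn2

end LegendrePolynomial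

section Main

variable {p n : ℕ} [Fact p.Prime]

theorem sum_inv_sq_half_reflect (hp : p = 2 * n + 1) (hn : 2 ≤ n) {k : ℕ} (hk : k ≤ n) :
    ∑ i ∈ range (n - k), (i + 1 : ZMod p)⁻¹ ^ 2 =
      -4 * ∑ j ∈ range k, (2 * j + 1 : ZMod p)⁻¹ ^ 2 := by
  have h2 : (2 : ZMod p) ≠ 0 :=
    left_ne_zero_of_mul (two_mul_succ_zmod_ne_zero hp (j := 0) (by omega))
  induction k with
  | zero =>
    have h := sum_odd_sq_pow_mul_inv_sq hp hn (e := 0) (by omega)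
    simp only [pow_zero, one_mul, zero_ne_one, if_false] at h
    rw [sum_odd_eq_sum_neg_even hp (fun x => x⁻¹ ^ 2)] at h
    simp only [inv_neg, neg_sq, mul_inv, mul_pow] at h
    rw [← mul_sum] at h
    simpa [h2] using h
  | succ k ih =>
    have h := ih (by omega)
    rw [show n - k = n - (k + 1) + 1 by omega, sum_range_succ] at h
    rw [sum_range_succ, mul_add, ← h, Nat.cast_sub hk]
    push_cast
    have hk1 := two_mul_add_one_zmod_ne_zero hp (j := k) (by omega)
    have hnk : (n - (k + 1) + 1 : ZMod p) = -(2 * k + 1) * 2⁻¹ := by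
      field_simp
      linear_combination two_mul_half_add_one hp
    rw [hnk, mul_inv, inv_inv, inv_neg]
    ring

theorem sum_inv_sq_two_mul {K : Type*} [Field K] (k : ℕ) :
    ∑ i ∈ range (2 * k), (i + 1 : K)⁻¹ ^ 2 = ∑ j ∈ range k, (2 * j + 1 : K)⁻¹ ^ 2 +
      4⁻¹ * ∑ i ∈ range k, (i + 1 : K)⁻¹ ^ 2 := by
  rw [sum_range_two_mul (fun i => (i + 1 : K)⁻¹ ^ 2), mul_sum]
  push_cast
  congr 1
  refine sum_congr rfl fun i _ => ?_
  rw [show (2 * i + 1 + 1 : K) = 2 * (i + 1) by ring, mul_inv, mul_pow, inv_pow 2]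
  norm_num

theorem sum_choose_sq_mul_harmonic2 (hp : p = 2 * n + 1) (hn : 2 ≤ n) {b : ZMod p}
    (hb : ReducesTo p (bernoulli (p - 3)) b) :
    ∑ k ∈ range n, (n.choose k : ZMod p) ^ 2 / (2 * k + 1) *
      ∑ i ∈ range (2 * k), (i + 1 : ZMod p)⁻¹ ^ 2 = -(5 / 4) * b := by
  have h2 : (2 : ZMod p) ≠ 0 :=
    left_ne_zero_of_mul (two_mul_succ_zmod_ne_zero hp (j := 0) (by omega))
  have h4 : (4 : ZMod p) ≠ 0 := by
    convert mul_ne_zero h2 h2 using 1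
    norm_num
  have hO := sum_choose_sq_mul_div_odd hp hn hb
  have hS := sum_choose_sq_mul_div_succ hp hn hb
  have hH : ∑ k ∈ range n, (n.choose k : ZMod p) ^ 2 / (2 * k + 1) *
      ∑ i ∈ range k, (i + 1 : ZMod p)⁻¹ ^ 2 = -7 * b := by
    rw [← hS, mul_sum, ← sum_range_reflect]
    refine sum_congr rfl fun k hk => ?_
    rw [mem_range] at hk
    have hk0 := right_ne_zero_of_mul (two_mul_succ_zmod_ne_zero hp hk)
    have hcast : ((2 * (n - (k + 1) : ℕ) : ZMod p) + 1) = -2 * (k + 1) := by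
      push_cast [Nat.cast_sub (show k + 1 ≤ n from hk)]
      linear_combination two_mul_half_add_one hp
    rw [show n - 1 - k = n - (k + 1) by omega, Nat.choose_symm hk,
      sum_inv_sq_half_reflect hp hn hk, hcast]
    field_simp
    ring
  simp only [sum_inv_sq_two_mul, mul_add, sum_add_distrib]
  simp only [mul_left_comm _ (4 : ZMod p)⁻¹]
  rw [← mul_sum, hH]
  generalize ∑ k ∈ range n, (n.choose k : ZMod p) ^ 2 / (2 * k + 1) *
    ∑ j ∈ range k, (2 * j + 1 : ZMod p)⁻¹ ^ 2 = S at hO ⊢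
  field_simp
  linear_combination 2 * hO

end Main

/-- Lemma 3.1: for a prime `p > 3`,
`∑_{k=0}^{(p-3)/2} C(2k,k)^2/((2k+1) 16^k) H^{(2)}_{2k} ≡ -(5/4) B_{p-3} (mod p)`
as rational numbers. -/
theorem lemma_h2k (p : ℕ) (hp : p.Prime) (hp3 : 3 < p) :
    (p : ℤ) ∣
      ((∑ k ∈ Finset.range ((p - 3) / 2 + 1),
          ((2 * k).choose k : ℚ) ^ 2 / ((2 * (k : ℚ) + 1) * 16 ^ k) * harmonic2 (2 * k)) -
        (-(5 / 4) * bernoulli (p - 3))).num := by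
  have : Fact p.Prime := ⟨hp⟩
  obtain ⟨n, hpn⟩ : ∃ n, p = 2 * n + 1 := hp.odd_of_ne_two (by omega)
  have hn : 2 ≤ n := by omega
  obtain ⟨b, hb⟩ := exists_reducesTo_bernoulli (p := p) (p - 3) (by omega)
  have h2 : (2 : ZMod p) ≠ 0 :=
    left_ne_zero_of_mul (two_mul_succ_zmod_ne_zero hpn (j := 0) (by omega))
  have h4 : ((4 : ℕ) : ZMod p) ≠ 0 := by
    convert mul_ne_zero h2 h2 using 1
    norm_num
  have h16 : ((16 : ℕ) : ZMod p) ≠ 0 := by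
    convert mul_ne_zero h4 h4 using 1
    norm_num
  have hterm : ∀ k ∈ range n, ReducesTo p
      (((2 * k).choose k : ℚ) ^ 2 / ((2 * (k : ℚ) + 1) * 16 ^ k) * harmonic2 (2 * k))
      ((n.choose k : ZMod p) ^ 2 / (2 * k + 1) *
        ∑ i ∈ range (2 * k), (i + 1 : ZMod p)⁻¹ ^ 2) := by
    intro k hk
    rw [mem_range] at hk
    have hk1 := two_mul_add_one_zmod_ne_zero hpn hk
    refine ReducesTo.mul ?_ (ReducesTo.sum fun i hi => ReducesTo.pow (ReducesTo.inv ?_ ?_) 2)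
    · have hred := ((ReducesTo.natCast (p := p) ((2 * k).choose k)).pow 2).div
        ((ReducesTo.natCast (2 * k + 1)).mul ((ReducesTo.natCast 16).pow k))
        (mul_ne_zero (by exact_mod_cast hk1) (pow_ne_zero k h16))
      convert hred using 1
      · push_cast
        rfl
      · rw [centralBinom_zmod hpn hk.le, mul_pow, ← pow_mul, mul_comm k 2, pow_mul]
        have h16' : (16 : ZMod p) ≠ 0 := by exact_mod_cast h16
        push_cast
        norm_num
        field_simp
    · exact_mod_cast ReducesTo.natCast (p := p) (i + 1)
    · rw [mem_range] at hi
      exact_mod_cast natCast_zmod_ne_zero (p := p) (k := i + 1) (by omega) (by omega)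
  have h54 : ReducesTo p (-(5 / 4)) (-(5 / 4)) := by
    exact_mod_cast ((ReducesTo.natCast (p := p) 5).div (ReducesTo.natCast 4) h4).neg
  have hmain := (ReducesTo.sum hterm).sub (h54.mul hb)
  rw [sum_choose_sq_mul_harmonic2 hpn hn hb, sub_self] at hmain
  rw [show (p - 3) / 2 + 1 = n by omega]
  exact hmain.dvd_num
end

section
/- For any positive integer n, the following identity of rational numbers holds: ∑_{k=0}^{n-1} (3k+1)/(-16)^k * binom(2k,k) * f_k = (n / 4^{n-1}) * binom(2n-1,n-1) * ∑_{j=0}^{n-1} binom(2j,j) * (3j+1) * binom(3j,j) * binom(n+2j,3j+1) / ((2j+1) * (-4)^j). -/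
/-- The Franel numbers `f n = ∑ k ≤ n, (n.choose k)^3`. -/
def franel (n : ℕ) : ℕ := ∑ k ∈ Finset.range (n + 1), (n.choose k) ^ 3

/-- The numbers `(n + 2k)! / ((n - k)! k!^3)`, as a product of binomial coefficients. -/
def franelCoeff (n k : ℕ) : ℚ :=
  ((n + 2 * k).choose (3 * k) : ℚ) * ((2 * k).choose k : ℚ) * ((3 * k).choose k : ℚ)

/-- The alternating sum which turns out to be another expression for the Franel numbers. -/
def franelSum (n : ℕ) : ℚ :=
  ∑ k ∈ Finset.range (n + 1), franelCoeff n k * ((-4) ^ n / (-4) ^ k)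

lemma cast_choose_succ_mul (a b : ℕ) :
    (a.choose b : ℚ) * (a + 1) = ((a + 1).choose b : ℚ) * (a + 1 - b) := by
  have h := Nat.choose_mul_succ_eq a b
  rcases le_or_gt b (a + 1) with hb | hb
  · have h' : ((a.choose b * (a + 1) : ℕ) : ℚ) = (((a + 1).choose b * (a + 1 - b) : ℕ) : ℚ) := by
      rw [h]
    push_cast [Nat.cast_sub hb] at h'
    exact h'
  · simp [Nat.choose_eq_zero_of_lt hb, Nat.choose_eq_zero_of_lt (show a < b by omega)]

lemma cast_choose_mul_succ (a b : ℕ) :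
    (a.choose (b + 1) : ℚ) * (b + 1) = (a.choose b : ℚ) * (a - b) := by
  rcases le_or_gt b a with hb | hb
  · have h' : ((a.choose (b + 1) * (b + 1) : ℕ) : ℚ) = ((a.choose b * (a - b) : ℕ) : ℚ) := by
      rw [Nat.choose_succ_right_eq]
    push_cast [Nat.cast_sub hb] at h'
    exact h'
  · simp [Nat.choose_eq_zero_of_lt hb, Nat.choose_eq_zero_of_lt (show a < b + 1 by omega)]

lemma franelCoeff_of_lt {n k : ℕ} (h : n < k) : franelCoeff n k = 0 := by
  simp [franelCoeff, Nat.choose_eq_zero_of_lt (show n + 2 * k < 3 * k by omega)]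

lemma franelCoeff_succ_left (n k : ℕ) :
    franelCoeff n k * (n + 2 * k + 1) = franelCoeff (n + 1) k * (n + 1 - k) := by
  have h := cast_choose_succ_mul (n + 2 * k) (3 * k)
  rw [show n + 2 * k + 1 = n + 1 + 2 * k by ring] at h
  push_cast at h
  unfold franelCoeff
  linear_combination ((2 * k).choose k : ℚ) * ((3 * k).choose k : ℚ) * h

lemma franelCoeff_eq_factorial (d k : ℕ) :
    franelCoeff (k + d) k =
      ((3 * k + d).factorial : ℚ) / ((d.factorial : ℚ) * (k.factorial : ℚ) ^ 3) := by
  have h₁ := Nat.cast_add_choose ℚ (a := 3 * k) (b := d)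
  have h₂ := Nat.cast_add_choose ℚ (a := k) (b := k)
  have h₃ := Nat.cast_add_choose ℚ (a := k) (b := 2 * k)
  rw [show k + k = 2 * k by ring] at h₂
  rw [show k + 2 * k = 3 * k by ring] at h₃
  rw [franelCoeff, show k + d + 2 * k = 3 * k + d by ring, h₁, h₂, h₃]
  field_simp

lemma franelCoeff_succ_right (n k : ℕ) :
    franelCoeff n (k + 1) * (k + 1) ^ 3 =
      franelCoeff n k * ((n + 2 * k + 1) * (n + 2 * k + 2) * (n - k)) := by
  rcases lt_or_ge k n with h | h
  · obtain ⟨d, rfl⟩ := Nat.exists_eq_add_of_le h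
    rw [show k.succ + d = k + 1 + d from rfl, franelCoeff_eq_factorial,
      show k + 1 + d = k + (d + 1) by ring, franelCoeff_eq_factorial,
      show 3 * (k + 1) + d = 3 * k + (d + 1) + 1 + 1 by ring]
    simp only [Nat.factorial_succ (3 * k + (d + 1) + 1), Nat.factorial_succ (3 * k + (d + 1)),
      Nat.factorial_succ k, Nat.factorial_succ d]
    have hd : (d.factorial : ℚ) ≠ 0 := by positivity
    have hk : (k.factorial : ℚ) ≠ 0 := by positivity
    push_cast
    field_simp
    ring
  · rw [franelCoeff_of_lt (Nat.lt_succ_of_le h)]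
    rcases h.eq_or_lt with rfl | h
    · simp
    · simp [franelCoeff_of_lt h]

/-- Partial sums of the creative-telescoping relation for `franelSum`. -/
lemma franelCoeff_telescope (n m : ℕ) :
    ∑ k ∈ Finset.range (m + 1),
      ((n + 2) ^ 2 * (franelCoeff (n + 2) k * ((-4) ^ (n + 2) / (-4) ^ k))
        - (7 * n ^ 2 + 21 * n + 16) * (franelCoeff (n + 1) k * ((-4) ^ (n + 1) / (-4) ^ k))
        - 8 * (n + 1) ^ 2 * (franelCoeff n k * ((-4) ^ n / (-4) ^ k))) =
      12 * (3 * n + 5) * (n + 2 - m) * franelCoeff (n + 2) m * ((-4 : ℚ) ^ n / (-4) ^ m) := by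
  have key (k : ℕ) :
      franelCoeff (n + 1) k = franelCoeff (n + 2) k * (n + 2 - k) / (n + 2 * k + 2) ∧
      franelCoeff n k =
        franelCoeff (n + 2) k * (n + 2 - k) * (n + 1 - k) /
          ((n + 2 * k + 2) * (n + 2 * k + 1)) := by
    have h₁ := franelCoeff_succ_left (n + 1) k
    have h₂ := franelCoeff_succ_left n k
    push_cast at h₁ h₂
    have e₁ : franelCoeff (n + 1) k =
        franelCoeff (n + 2) k * (n + 2 - k) / (n + 2 * k + 2) := by
      rw [eq_div_iff (by positivity)]
      linear_combination h₁
    refine ⟨e₁, ?_⟩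
    rw [e₁] at h₂
    rw [← mul_left_inj' (show (n + 2 * k + 1 : ℚ) ≠ 0 by positivity), h₂]
    field_simp
  induction m with
  | zero =>
    rw [Finset.sum_range_one, (key 0).1, (key 0).2]
    push_cast
    field_simp
    ring
  | succ m ih =>
    rw [Finset.sum_range_succ, ih, (key (m + 1)).1, (key (m + 1)).2]
    have h := franelCoeff_succ_right (n + 2) m
    have e : franelCoeff (n + 2) m * (n + 2 - m) =
        franelCoeff (n + 2) (m + 1) * (m + 1) ^ 3 / ((n + 2 * m + 3) * (n + 2 * m + 4)) := by
      push_cast at h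
      rw [eq_div_iff (by positivity)]
      linear_combination -h
    rw [show 12 * (3 * (n : ℚ) + 5) * (n + 2 - m) * franelCoeff (n + 2) m *
          ((-4 : ℚ) ^ n / (-4) ^ m) =
        12 * (3 * n + 5) * (franelCoeff (n + 2) m * (n + 2 - m)) *
          ((-4 : ℚ) ^ n / (-4) ^ m) by ring, e]
    have h₃ : (n + 2 * m + 3 : ℚ) ≠ 0 := by positivity
    have h₄ : (n + 2 * m + 4 : ℚ) ≠ 0 := by positivity
    have h₅ : (n + 2 * (m + 1) + 2 : ℚ) ≠ 0 := by positivity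
    have h₆ : (n + 2 * (m + 1) + 1 : ℚ) ≠ 0 := by positivity
    push_cast
    field_simp
    ring

lemma franelSum_eq_sum_range {n N : ℕ} (h : n < N) :
    franelSum n = ∑ k ∈ Finset.range N, franelCoeff n k * ((-4) ^ n / (-4) ^ k) := by
  refine Finset.sum_subset (Finset.range_mono h) fun k _ hk => ?_
  rw [franelCoeff_of_lt (by simpa [Nat.lt_succ_iff] using hk), zero_mul]

lemma franelSum_recurrence (n : ℕ) :
    (n + 2) ^ 2 * franelSum (n + 2) - (7 * n ^ 2 + 21 * n + 16) * franelSum (n + 1)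
      - 8 * (n + 1) ^ 2 * franelSum n = 0 := by
  have h := franelCoeff_telescope n (n + 2)
  simp only [Finset.sum_sub_distrib, ← Finset.mul_sum] at h
  rw [franelSum_eq_sum_range (show n + 2 < n + 2 + 1 by omega),
    franelSum_eq_sum_range (show n + 1 < n + 2 + 1 by omega),
    franelSum_eq_sum_range (show n < n + 2 + 1 by omega), h]
  push_cast
  ring

/-- Partial sums of the creative-telescoping relation for the cubes of binomial coefficients. -/
lemma choose_cube_telescope (n m : ℕ) :
    (n + 1) * ∑ k ∈ Finset.range (m + 1),
      ((n + 2) ^ 2 * ((n + 2).choose k : ℚ) ^ 3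
        - (7 * n ^ 2 + 21 * n + 16) * ((n + 1).choose k : ℚ) ^ 3
        - 8 * (n + 1) ^ 2 * (n.choose k : ℚ) ^ 3) =
      (4 * m ^ 3 - 18 * (n + 1) * m ^ 2 + 3 * (n + 1) * (9 * n + 10) * m
        - (n + 1) * (14 * n ^ 2 + 33 * n + 20)) * ((n + 1).choose m : ℚ) ^ 3 := by
  induction m with
  | zero => simp; ring
  | succ m ih =>
    rw [Finset.sum_range_succ, mul_add, ih]
    have hn : (n + 2 : ℚ) ≠ 0 := by positivity
    have hn' : (n + 1 : ℚ) ≠ 0 := by positivity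
    have pascal : ((n + 2).choose (m + 1) : ℚ) =
        (n + 1).choose m + (n + 1).choose (m + 1) := by
      exact_mod_cast Nat.choose_succ_succ (n + 1) m
    have h₁ := cast_choose_mul_succ (n + 1) m
    have h₂ := cast_choose_succ_mul n (m + 1)
    push_cast at h₁ h₂
    obtain ⟨w, hw⟩ : ∃ w : ℚ, ((n + 2).choose (m + 1) : ℚ) = (n + 2) * w :=
      ⟨_, (mul_div_cancel₀ _ hn).symm⟩
    rw [hw] at pascal
    have hu : ((n + 1).choose (m + 1) : ℚ) = (n + 1 - m) * w := by
      rw [← mul_right_inj' hn]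
      linear_combination h₁ - (n + 1 - m) * pascal
    have hv : ((n + 1).choose m : ℚ) = (m + 1) * w := by
      linear_combination -pascal - hu
    have hx : (n.choose (m + 1) : ℚ) = (n + 1 - m) * w * (n - m) / (n + 1) := by
      rw [eq_div_iff hn', h₂, hu]
      ring
    rw [hw, hu, hv, hx]
    push_cast
    field_simp
    ring

lemma franel_eq_sum_range {n N : ℕ} (h : n < N) :
    (franel n : ℚ) = ∑ k ∈ Finset.range N, (n.choose k : ℚ) ^ 3 := by
  unfold franel
  push_cast
  refine Finset.sum_subset (Finset.range_mono h) fun k _ hk => ?_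
  simp [Nat.choose_eq_zero_of_lt (show n < k by simpa [Nat.lt_succ_iff] using hk)]

lemma franel_recurrence (n : ℕ) :
    (n + 2) ^ 2 * (franel (n + 2) : ℚ) - (7 * n ^ 2 + 21 * n + 16) * franel (n + 1)
      - 8 * (n + 1) ^ 2 * franel n = 0 := by
  have h := choose_cube_telescope n (n + 2)
  simp only [Finset.sum_sub_distrib, ← Finset.mul_sum] at h
  rw [← franel_eq_sum_range (show n + 2 < n + 2 + 1 by omega),
    ← franel_eq_sum_range (show n + 1 < n + 2 + 1 by omega),
    ← franel_eq_sum_range (show n < n + 2 + 1 by omega),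
    Nat.choose_eq_zero_of_lt (show n + 1 < n + 2 by omega)] at h
  have hn : (n + 1 : ℚ) ≠ 0 := by positivity
  simpa [hn] using h

theorem franel_eq_franelSum (n : ℕ) : (franel n : ℚ) = franelSum n := by
  induction n using Nat.twoStepInduction with
  | zero => simp [franel, franelSum, franelCoeff]
  | one => norm_num [franel, franelSum, franelCoeff, Finset.sum_range_succ, Nat.choose]
  | more n ih₀ ih₁ =>
    have h₁ := franel_recurrence n
    have h₂ := franelSum_recurrence n
    rw [ih₀, ih₁] at h₁
    rw [← mul_right_inj' (show ((n : ℚ) + 2) ^ 2 ≠ 0 by positivity)]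
    linear_combination h₁ - h₂

/-- Indefinite summation in `k` of `(3k+1) C(2k,k) C(k+2j,3j) / 4^k`. -/
lemma sum_centralBinom_mul_choose (j n : ℕ) :
    ∑ k ∈ Finset.range (n + 1), (3 * (k : ℚ) + 1) / 4 ^ k * ((2 * k).choose k : ℚ) *
        ((k + 2 * j).choose (3 * j) : ℚ) =
      (n + 1) / 4 ^ n * ((2 * n + 1).choose n : ℚ) *
        ((3 * j + 1) * ((n + 1 + 2 * j).choose (3 * j + 1) : ℚ) / (2 * j + 1)) := by
  induction n with
  | zero =>
    have h : ((2 * j + 1 : ℕ) : ℚ) * ((2 * j).choose (3 * j) : ℚ) =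
        ((2 * j + 1).choose (3 * j + 1) : ℚ) * ((3 * j + 1 : ℕ) : ℚ) := by
      exact_mod_cast Nat.add_one_mul_choose_eq (2 * j) (3 * j)
    push_cast at h
    simp only [zero_add, add_comm 1 (2 * j), Finset.sum_range_one]
    field_simp
    simp
    linear_combination h
  | succ n ih =>
    rw [Finset.sum_range_succ, ih]
    have h₁ := cast_choose_succ_mul (2 * n + 2) (n + 1)
    have h₂ : ((2 * n + 2).choose (n + 1) : ℚ) = 2 * (2 * n + 1).choose n := by
      have h := Nat.choose_succ_succ (2 * n + 1) n
      rw [Nat.succ_eq_add_one, Nat.succ_eq_add_one, Nat.choose_symm_half] at h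
      exact_mod_cast h.trans (two_mul _).symm
    have h₃ : ((n + 1 + 1 + 2 * j).choose (3 * j + 1) : ℚ) =
        (n + 1 + 2 * j).choose (3 * j) + (n + 1 + 2 * j).choose (3 * j + 1) := by
      rw [show n + 1 + 1 + 2 * j = n + 1 + 2 * j + 1 by ring]
      exact_mod_cast Nat.choose_succ_succ (n + 1 + 2 * j) (3 * j)
    have h₄ := cast_choose_mul_succ (n + 1 + 2 * j) (3 * j)
    push_cast at h₁ h₄
    have h₅ : ((2 * n + 3).choose (n + 1) : ℚ) =
        2 * (2 * n + 3) * (2 * n + 1).choose n / (n + 2) := by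
      rw [eq_div_iff (by positivity)]
      rw [h₂] at h₁
      linear_combination -h₁
    have h₆ : ((n + 1 + 2 * j).choose (3 * j + 1) : ℚ) =
        (n + 1 + 2 * j).choose (3 * j) * (n + 1 - j) / (3 * j + 1) := by
      rw [eq_div_iff (by positivity)]
      linear_combination h₄
    rw [show 2 * (n + 1) + 1 = 2 * n + 3 by ring, show 2 * (n + 1) = 2 * n + 2 by ring,
      h₃, h₅, h₂, h₆]
    push_cast
    field_simp
    ring


/-- The identity preceding (2.3): for any positive integer `n`,
`∑_{k=0}^{n-1} (3k+1)/(-16)^k C(2k,k) f_k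
  = (n/4^{n-1}) C(2n-1,n-1) ∑_{j=0}^{n-1} C(2j,j)(3j+1) C(3j,j) C(n+2j,3j+1)/((2j+1)(-4)^j)`. -/
theorem franel_transform (n : ℕ) (hn : 0 < n) :
    ∑ k ∈ Finset.range n,
        (3 * (k : ℚ) + 1) / (-16) ^ k * ((2 * k).choose k : ℚ) * (franel k : ℚ) =
      (n : ℚ) / 4 ^ (n - 1) * ((2 * n - 1).choose (n - 1) : ℚ) *
        ∑ j ∈ Finset.range n,
          ((2 * j).choose j : ℚ) * (3 * (j : ℚ) + 1) * ((3 * j).choose j : ℚ) *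
            ((n + 2 * j).choose (3 * j + 1) : ℚ) / ((2 * (j : ℚ) + 1) * (-4) ^ j) := by
  obtain ⟨n, rfl⟩ : ∃ m, n = m + 1 := ⟨n - 1, by omega⟩
  have expand : ∀ k ∈ Finset.range (n + 1),
      (3 * (k : ℚ) + 1) / (-16) ^ k * ((2 * k).choose k : ℚ) * (franel k : ℚ) =
        ∑ j ∈ Finset.range (n + 1), ((2 * j).choose j : ℚ) * ((3 * j).choose j : ℚ) / (-4) ^ j *
          ((3 * (k : ℚ) + 1) / 4 ^ k * ((2 * k).choose k : ℚ) *
            ((k + 2 * j).choose (3 * j) : ℚ)) := by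
    intro k hk
    rw [franel_eq_franelSum, franelSum_eq_sum_range (Finset.mem_range.mp hk), Finset.mul_sum]
    refine Finset.sum_congr rfl fun j _ => ?_
    rw [franelCoeff, show (-16 : ℚ) = 4 * -4 by norm_num, mul_pow]
    field_simp
  rw [Finset.sum_congr rfl expand, Finset.sum_comm, Finset.mul_sum]
  refine Finset.sum_congr rfl fun j _ => ?_
  rw [← Finset.mul_sum, sum_centralBinom_mul_choose, show 2 * (n + 1) - 1 = 2 * n + 1 by omega,
    Nat.add_sub_cancel]
  push_cast
  field_simp
end

section
/- Let p > 3 be a prime. Then ∑_{k=0}^{p-1} (3k+1)/(-16)^k * binom(2k,k) * f_k ≡ (p / 4^{p-1}) * (S_1 + S_2 + S_3) modulo p^4, where S_1 = p * ∑_{j=0}^{(p-3)/2} binom(2j,j)/4^j * (1 + p*H_{2j} − p*H_j)/(2j+1), S_2 = binom(2p-1,p-1) * binom(p-1,(p-1)/2)^2 / (-4)^{(p-1)/2}, and S_3 = 2p * ∑_{j=(p+1)/2}^{p-1} binom(2j,j) / ((2j+1) * 4^j), the congruence being understood in the rational numbers. -/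
namespace FranelCongruence

open Finset

/-! ### Binomial coefficients in `ℚ` -/

theorem cast_choose_succ_right (n k : ℕ) :
    (n.choose (k + 1) : ℚ) * (k + 1) = n.choose k * (n - k) := by
  rcases le_or_gt k n with h | h
  · have := Nat.choose_succ_right_eq n k
    rw [← Nat.cast_sub h]
    exact_mod_cast this
  · simp [Nat.choose_eq_zero_of_lt h, Nat.choose_eq_zero_of_lt (Nat.lt_succ_of_lt h)]

theorem cast_choose_succ_succ_mul (n k : ℕ) :
    ((n + 1).choose (k + 1) : ℚ) * (k + 1) = (n + 1) * n.choose k := by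
  exact_mod_cast (Nat.add_one_mul_choose_eq n k).symm

theorem cast_choose_succ_left (n k : ℕ) :
    ((n + 1).choose k : ℚ) * (n + 1 - k) = (n + 1) * n.choose k := by
  have h := cast_choose_succ_right (n + 1) k
  rw [cast_choose_succ_succ_mul] at h
  push_cast at h
  exact h.symm

theorem cast_choose_add_three (n k : ℕ) :
    ((n + 3).choose (k + 3) : ℚ) =
      n.choose k * ((n + 1) * (n + 2) * (n + 3)) / ((k + 1) * (k + 2) * (k + 3)) := by
  have h₁ := cast_choose_succ_succ_mul n k
  have h₂ := cast_choose_succ_succ_mul (n + 1) (k + 1)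
  have h₃ := cast_choose_succ_succ_mul (n + 2) (k + 2)
  push_cast at h₂ h₃
  rw [eq_div_iff (by positivity)]
  linear_combination (k + 1) * (k + 2) * h₃ + (n + 3) * (k + 1) * h₂ + (n + 3) * (n + 2) * h₁

theorem cast_choose_add_two_add_three (n k : ℕ) :
    ((n + 2).choose (k + 3) : ℚ) =
      n.choose k * ((n - k) * (n + 1) * (n + 2)) / ((k + 1) * (k + 2) * (k + 3)) := by
  have h₁ := cast_choose_succ_right n k
  have h₂ := cast_choose_succ_succ_mul n (k + 1)
  have h₃ := cast_choose_succ_succ_mul (n + 1) (k + 2)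
  push_cast at h₂ h₃
  rw [eq_div_iff (by positivity)]
  linear_combination (k + 1) * (k + 2) * h₃ + (n + 2) * (k + 1) * h₂ + (n + 2) * (n + 1) * h₁

theorem cast_choose_add_one_add_three (n k : ℕ) :
    ((n + 1).choose (k + 3) : ℚ) =
      n.choose k * ((n - k) * (n - k - 1) * (n + 1)) / ((k + 1) * (k + 2) * (k + 3)) := by
  have h₁ := cast_choose_succ_right n k
  have h₂ := cast_choose_succ_right n (k + 1)
  have h₃ := cast_choose_succ_succ_mul n (k + 2)
  push_cast at h₂ h₃
  rw [eq_div_iff (by positivity)]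
  linear_combination (k + 1) * (k + 2) * h₃ + (n + 1) * (k + 1) * h₂ + (n + 1) * (n - k - 1) * h₁

theorem cast_choose_two_mul_succ (j : ℕ) :
    ((2 * (j + 1)).choose (j + 1) : ℚ) =
      (2 * j).choose j * (2 * (2 * j + 1)) / (j + 1) := by
  have h := Nat.succ_mul_centralBinom_succ j
  rw [Nat.centralBinom, Nat.centralBinom] at h
  rw [eq_div_iff (by positivity)]
  have h' : ((j : ℚ) + 1) * ((2 * (j + 1)).choose (j + 1) : ℚ) =
      2 * (2 * j + 1) * (2 * j).choose j := by exact_mod_cast h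
  linear_combination h'

/-! ### A transformation formula for the Franel numbers -/

/-- The multinomial coefficient `(3j)! / (j!)^3`. -/
def trinomial (j : ℕ) : ℚ := (3 * j).factorial / (j.factorial : ℚ) ^ 3

theorem trinomial_succ (j : ℕ) :
    trinomial (j + 1) =
      trinomial j * ((3 * j + 1) * (3 * j + 2) * (3 * j + 3)) / (j + 1) ^ 3 := by
  have hj : (j.factorial : ℚ) ≠ 0 := by positivity
  simp only [trinomial, show 3 * (j + 1) = 3 * j + 1 + 1 + 1 by ring, Nat.factorial_succ]
  push_cast
  field_simp
  ring

/-- The operator of the Franel recurrence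
`(n+2)² u(n+2) = (7n²+21n+16) u(n+1) + 8(n+1)² u(n)`. -/
def franelOp (u : ℕ → ℚ) (n : ℕ) : ℚ :=
  (n + 2) ^ 2 * u (n + 2) - (7 * n ^ 2 + 21 * n + 16) * u (n + 1) - 8 * (n + 1) ^ 2 * u n

theorem franelOp_sum (u : ℕ → ℕ → ℚ) (s : Finset ℕ) (n : ℕ) :
    franelOp (fun m => ∑ k ∈ s, u m k) n = ∑ k ∈ s, franelOp (fun m => u m k) n := by
  simp only [franelOp, Finset.mul_sum, Finset.sum_sub_distrib]

theorem eq_of_franelOp_eq_zero {u v : ℕ → ℚ} (hu : ∀ n, franelOp u n = 0)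
    (hv : ∀ n, franelOp v n = 0) (h₀ : u 0 = v 0) (h₁ : u 1 = v 1) : u = v := by
  suffices h : ∀ n, u n = v n ∧ u (n + 1) = v (n + 1) from funext fun n => (h n).1
  intro n
  induction n with
  | zero => exact ⟨h₀, h₁⟩
  | succ n ih =>
    refine ⟨ih.2, ?_⟩
    have hun := hu n
    have hvn := hv n
    simp only [franelOp] at hun hvn
    rw [ih.1, ih.2] at hun
    have hn : ((n : ℚ) + 2) ^ 2 ≠ 0 := by positivity
    exact mul_left_cancel₀ hn (by linear_combination hun - hvn)

theorem sum_franelOp_choose_pow_three (n K : ℕ) :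
    ∑ k ∈ range (K + 1), franelOp (fun m => (m.choose k : ℚ) ^ 3) n =
      ((n + 1).choose K : ℚ) ^ 3 / (n + 1) *
        (4 * K ^ 3 - 18 * (n + 1) * K ^ 2 + 3 * (9 * n + 10) * (n + 1) * K
          - (n + 1) * (14 * n ^ 2 + 33 * n + 20)) := by
  induction K with
  | zero =>
    simp [franelOp]
    field_simp
    ring
  | succ K ih =>
    rw [sum_range_succ, ih]
    have hw : ((n + 1).choose (K + 1) : ℚ) = (n + 1).choose K * (n + 1 - K) / (K + 1) := by
      rw [eq_div_iff (by positivity)]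
      exact_mod_cast cast_choose_succ_right (n + 1) K
    have hy : (n.choose (K + 1) : ℚ) = (n + 1).choose (K + 1) * (n - K) / (n + 1) := by
      rw [eq_div_iff (by positivity)]
      have := cast_choose_succ_left n (K + 1)
      push_cast at this
      linear_combination -this
    have hx : ((n + 2).choose (K + 1) : ℚ) = (n + 1).choose K + (n + 1).choose (K + 1) := by
      exact_mod_cast Nat.choose_succ_succ (n + 1) K
    simp only [franelOp, hx, hy, hw]
    push_cast
    field_simp
    ring

theorem sum_franelOp_trinomial (n K : ℕ) :
    ∑ k ∈ range (K + 1),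
        franelOp (fun m => trinomial k * (m + 2 * k).choose (3 * k) * ((-4) ^ m / (-4) ^ k)) n =
      trinomial K * (n + 1 + 2 * K).choose (3 * K) * ((-4) ^ n / (-4) ^ K) *
        ((n + 2 * K + 2) * (12 * (3 * n + 5))) := by
  induction K with
  | zero =>
    simp [franelOp, trinomial]
    ring
  | succ K ih =>
    rw [sum_range_succ, ih]
    have e₁ : n + 1 + 2 * (K + 1) = (n + 1 + 2 * K) + 2 := by ring
    have e₂ : n + 2 + 2 * (K + 1) = (n + 1 + 2 * K) + 3 := by ring
    have e₃ : n + 2 * (K + 1) = (n + 1 + 2 * K) + 1 := by ring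
    have e₄ : 3 * (K + 1) = 3 * K + 3 := by ring
    simp only [franelOp, e₁, e₂, e₃, e₄, trinomial_succ, cast_choose_add_three,
      cast_choose_add_two_add_three, cast_choose_add_one_add_three, pow_succ (-4 : ℚ)]
    push_cast
    field_simp
    ring

theorem franel_eq_sum_range {n N : ℕ} (h : n < N) :
    (franel n : ℚ) = ∑ k ∈ range N, (n.choose k : ℚ) ^ 3 := by
  rw [franel]
  push_cast
  refine sum_subset (range_mono h) fun k _ hk => ?_
  rw [Nat.choose_eq_zero_of_lt (by simpa using hk)]
  simp

theorem sum_trinomial_eq_sum_range {n N : ℕ} (h : n < N) :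
    ∑ k ∈ range (n + 1), trinomial k * (n + 2 * k).choose (3 * k) * ((-4) ^ n / (-4) ^ k) =
      ∑ k ∈ range N, trinomial k * (n + 2 * k).choose (3 * k) * ((-4) ^ n / (-4) ^ k) := by
  refine sum_subset (range_mono h) fun k _ hk => ?_
  have hk' : n < k := by simpa using hk
  rw [Nat.choose_eq_zero_of_lt (by omega)]
  simp

theorem franelOp_franel (n : ℕ) : franelOp (fun m => (franel m : ℚ)) n = 0 := by
  have h := sum_franelOp_choose_pow_three n (n + 2)
  rw [← franelOp_sum, Nat.choose_eq_zero_of_lt (by omega)] at h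
  simp only [franelOp] at h ⊢
  rw [franel_eq_sum_range (show n + 2 < n + 2 + 1 by omega),
    franel_eq_sum_range (show n + 1 < n + 2 + 1 by omega),
    franel_eq_sum_range (show n < n + 2 + 1 by omega), h]
  simp

theorem franelOp_sum_trinomial (n : ℕ) :
    franelOp (fun m => ∑ k ∈ range (m + 1),
      trinomial k * (m + 2 * k).choose (3 * k) * ((-4) ^ m / (-4) ^ k)) n = 0 := by
  have h := sum_franelOp_trinomial n (n + 2)
  rw [← franelOp_sum, Nat.choose_eq_zero_of_lt (by omega)] at h
  simp only [franelOp] at h ⊢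
  rw [sum_trinomial_eq_sum_range (show n + 2 < n + 2 + 1 by omega),
    sum_trinomial_eq_sum_range (show n + 1 < n + 2 + 1 by omega),
    sum_trinomial_eq_sum_range (show n < n + 2 + 1 by omega), h]
  simp

theorem franel_eq_sum_trinomial {n N : ℕ} (h : n < N) :
    (franel n : ℚ) =
      ∑ k ∈ range N, trinomial k * (n + 2 * k).choose (3 * k) * ((-4) ^ n / (-4) ^ k) := by
  rw [← sum_trinomial_eq_sum_range h]
  refine congrFun (eq_of_franelOp_eq_zero franelOp_franel franelOp_sum_trinomial ?_ ?_) n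
  · simp [franel, trinomial]
  · norm_num [franel, trinomial, sum_range_succ, Nat.choose, Nat.factorial]

/-! ### The weighted sum of Franel numbers in closed form -/

theorem sum_three_mul_add_one_mul_choose (j n : ℕ) :
    ∑ k ∈ range n, (3 * (k : ℚ) + 1) * (2 * k).choose k / 4 ^ k * (k + 2 * j).choose (3 * j) =
      2 * n * (n - j) * (2 * n).choose n * (n + 2 * j).choose (3 * j) / (4 ^ n * (2 * j + 1)) := by
  induction n with
  | zero => simp
  | succ n ih =>
    have h := cast_choose_succ_left (n + 2 * j) (3 * j)
    rw [show n + 2 * j + 1 = n + 1 + 2 * j by ring] at h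
    push_cast at h
    rw [sum_range_succ, ih, cast_choose_two_mul_succ]
    push_cast
    rw [pow_succ (4 : ℚ)]
    field_simp
    linear_combination -4 * ((2 * n).choose n : ℚ) * (2 * n + 1) * h

/-- The product `∏_{i ≤ 2j} (1 + p/i) * ∏_{i ≤ j} (1 - p/i)`. -/
def shiftProd (p j : ℕ) : ℚ :=
  (∏ i ∈ range (2 * j), (1 + (p : ℚ) * ((i + 1 : ℕ) : ℚ)⁻¹)) *
    ∏ i ∈ range j, (1 + -((p : ℚ) * ((i + 1 : ℕ) : ℚ)⁻¹))

theorem trinomial_mul_choose_mul_sub (p j : ℕ) :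
    trinomial j * (p + 2 * j).choose (3 * j) * (p - j) =
      p * (2 * j).choose j * (-1) ^ j * shiftProd p j := by
  induction j with
  | zero => simp [trinomial, shiftProd]
  | succ j ih =>
    have hs : shiftProd p (j + 1) = shiftProd p j *
        ((1 + p / (2 * j + 1)) * (1 + p / (2 * j + 2)) * (1 - p / (j + 1))) := by
      simp only [shiftProd, show 2 * (j + 1) = 2 * j + 1 + 1 by ring, prod_range_succ]
      push_cast
      ring
    rw [hs, show p + 2 * (j + 1) = p + 2 * j + 2 by ring, show 3 * (j + 1) = 3 * j + 3 by ring,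
      cast_choose_add_two_add_three, trinomial_succ, cast_choose_two_mul_succ, pow_succ (-1 : ℚ)]
    push_cast
    field_simp
    linear_combination (p + 2 * j + 1 : ℚ) * (p + 2 * j + 2) * (p - (j + 1)) * ih

theorem two_mul_choose_pred {p : ℕ} (hp : 0 < p) :
    ((2 * p).choose p : ℚ) = 2 * (2 * p - 1).choose (p - 1) := by
  obtain ⟨q, rfl⟩ := Nat.exists_eq_succ_of_ne_zero hp.ne'
  have h := cast_choose_succ_succ_mul (2 * q + 1) q
  have hq : (q : ℚ) + 1 ≠ 0 := by positivity
  rw [show 2 * q.succ - 1 = 2 * q + 1 by omega, show q.succ - 1 = q by omega,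
    show 2 * q.succ = 2 * q + 1 + 1 by omega]
  refine mul_right_cancel₀ hq ?_
  push_cast at h
  rw [Nat.succ_eq_add_one]
  linear_combination h

theorem sum_franel_eq {p : ℕ} (hp : 0 < p) :
    ∑ k ∈ range p, (3 * (k : ℚ) + 1) / (-16) ^ k * ((2 * k).choose k : ℚ) * (franel k : ℚ) =
      (p : ℚ) / 4 ^ (p - 1) * ∑ j ∈ range p, (2 * p - 1).choose (p - 1) *
        (p * ((2 * j).choose j / (4 ^ j * (2 * j + 1)) * shiftProd p j)) := by
  calc
    _ = ∑ k ∈ range p, ∑ j ∈ range p, trinomial j / (-4) ^ j *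
          ((3 * (k : ℚ) + 1) * (2 * k).choose k / 4 ^ k * (k + 2 * j).choose (3 * j)) := by
      refine sum_congr rfl fun k hk => ?_
      rw [franel_eq_sum_trinomial (mem_range.mp hk), mul_sum]
      refine sum_congr rfl fun j _ => ?_
      rw [show (-16 : ℚ) = 4 * (-4) by norm_num, mul_pow]
      field_simp
    _ = ∑ j ∈ range p, trinomial j / (-4) ^ j *
          (2 * p * (p - j) * (2 * p).choose p * (p + 2 * j).choose (3 * j) /
            (4 ^ p * (2 * j + 1))) := by
      rw [sum_comm]
      refine sum_congr rfl fun j _ => ?_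
      rw [← mul_sum, sum_three_mul_add_one_mul_choose]
    _ = _ := by
      rw [mul_sum]
      refine sum_congr rfl fun j _ => ?_
      have h := trinomial_mul_choose_mul_sub p j
      have h4 : (4 : ℚ) ^ p = 4 ^ (p - 1) * 4 := by
        rw [← pow_succ, Nat.sub_add_cancel hp]
      rw [two_mul_choose_pred hp, h4, show (-4 : ℚ) ^ j = (-1) ^ j * 4 ^ j by
        rw [← mul_pow]; norm_num]
      have h1 : ((-1 : ℚ)) ^ j ≠ 0 := by positivity
      field_simp
      linear_combination (4 * (2 * p - 1).choose (p - 1) : ℚ) * h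

/-! ### `p`-adic size of rational numbers -/

/-- The rational numbers that are divisible by `p ^ r` in the localization of `ℤ` at `p`. -/
def padicBall (p : ℕ) [Fact p.Prime] (r : ℕ) : AddSubgroup ℚ where
  carrier := {x | padicNorm p x ≤ (p : ℚ) ^ (-r : ℤ)}
  zero_mem' := by simp
  add_mem' := fun hx hy => padicNorm.nonarchimedean.trans (max_le hx hy)
  neg_mem' := fun hx => by simpa using hx

section Ball

variable {p : ℕ} [Fact p.Prime]

theorem mem_padicBall {r : ℕ} {x : ℚ} :
    x ∈ padicBall p r ↔ padicNorm p x ≤ (p : ℚ) ^ (-r : ℤ) := Iff.rfl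

attribute [irreducible] padicBall

theorem mem_padicBall_zero {x : ℚ} : x ∈ padicBall p 0 ↔ padicNorm p x ≤ 1 := by
  simp [mem_padicBall]

theorem padicBall_mul {r s : ℕ} {x y : ℚ} (hx : x ∈ padicBall p r) (hy : y ∈ padicBall p s) :
    x * y ∈ padicBall p (r + s) := by
  have hp : (p : ℚ) ≠ 0 := by exact_mod_cast (Fact.out : p.Prime).ne_zero
  rw [mem_padicBall] at *
  rw [padicNorm.mul, Nat.cast_add, neg_add, zpow_add₀ hp]
  exact mul_le_mul hx hy (padicNorm.nonneg _) (by positivity)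

theorem padicBall_anti {r s : ℕ} (h : r ≤ s) {x : ℚ} (hx : x ∈ padicBall p s) :
    x ∈ padicBall p r := by
  have hp : (1 : ℚ) ≤ p := by exact_mod_cast (Fact.out : p.Prime).one_le
  rw [mem_padicBall] at *
  exact hx.trans (zpow_le_zpow_right₀ hp (by omega))

theorem natCast_mem_padicBall (n : ℕ) : (n : ℚ) ∈ padicBall p 0 :=
  mem_padicBall_zero.mpr (padicNorm.of_nat n)

theorem one_mem_padicBall : (1 : ℚ) ∈ padicBall p 0 := by
  exact_mod_cast natCast_mem_padicBall (p := p) 1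

theorem natCast_mem_padicBall_one {n : ℕ} (h : p ∣ n) : (n : ℚ) ∈ padicBall p 1 := by
  have := (padicNorm.dvd_iff_norm_le (p := p) (n := 1) (z := n)).mp
    (by simpa using Int.natCast_dvd_natCast.mpr h)
  rw [mem_padicBall]
  exact_mod_cast this

theorem prime_mem_padicBall : (p : ℚ) ∈ padicBall p 1 :=
  natCast_mem_padicBall_one dvd_rfl

theorem inv_natCast_mem_padicBall {n : ℕ} (h : ¬p ∣ n) : ((n : ℚ))⁻¹ ∈ padicBall p 0 := by
  rw [mem_padicBall_zero, ← one_div, padicNorm.div, (padicNorm.nat_eq_one_iff n).mpr h]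
  simp

theorem pow_dvd_num_of_mem_padicBall {r : ℕ} {x : ℚ} (hx : x ∈ padicBall p r) :
    (p : ℤ) ^ r ∣ x.num := by
  have h : ((p ^ r : ℕ) : ℤ) ∣ x.num := by
    rw [padicNorm.dvd_iff_norm_le]
    have := padicBall_mul hx (natCast_mem_padicBall x.den)
    rwa [Rat.mul_den_eq_num, add_zero, mem_padicBall] at this
  exact_mod_cast h

theorem mem_padicBall_of_natCast_mul {r n : ℕ} {x : ℚ} (h : ¬p ∣ n)
    (hx : (n : ℚ) * x ∈ padicBall p r) : x ∈ padicBall p r := by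
  rwa [mem_padicBall, padicNorm.mul, (padicNorm.nat_eq_one_iff n).mpr h, one_mul,
    ← mem_padicBall] at hx

variable {ι : Type*} {r : ℕ} {x : ι → ℚ}

theorem prod_one_add_sub_one_mem (s : Finset ι) (hx : ∀ i ∈ s, x i ∈ padicBall p r) :
    ∏ i ∈ s, (1 + x i) - 1 ∈ padicBall p r := by
  classical
  induction s using Finset.induction_on with
  | empty => simp
  | insert a s ha ih =>
    have h₁ := hx a (mem_insert_self a s)
    have h₂ := ih fun i hi => hx i (mem_insert_of_mem hi)
    rw [prod_insert ha]
    have h₃ := padicBall_anti (Nat.le_add_right r r) (padicBall_mul h₁ h₂)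
    have h := add_mem (add_mem h₁ h₂) h₃
    convert h using 1
    ring

theorem prod_one_add_sub_one_sub_sum_mem (s : Finset ι) (hx : ∀ i ∈ s, x i ∈ padicBall p r) :
    ∏ i ∈ s, (1 + x i) - 1 - ∑ i ∈ s, x i ∈ padicBall p (r + r) := by
  classical
  induction s using Finset.induction_on with
  | empty => simp
  | insert a s ha ih =>
    have h₁ := hx a (mem_insert_self a s)
    have hs : ∀ i ∈ s, x i ∈ padicBall p r := fun i hi => hx i (mem_insert_of_mem hi)
    rw [prod_insert ha, sum_insert ha]
    have h := add_mem (ih hs) (padicBall_mul h₁ (prod_one_add_sub_one_mem s hs))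
    convert h using 1
    ring

theorem mul_sub_one_mem {a b : ℚ} (ha : a - 1 ∈ padicBall p r) (hb : b - 1 ∈ padicBall p r) :
    a * b - 1 ∈ padicBall p r := by
  have h := add_mem (add_mem ha hb) (padicBall_anti (Nat.le_add_right r r) (padicBall_mul ha hb))
  convert h using 1
  ring

end Ball

/-! ### Wolstenholme's congruence -/

theorem prod_one_add_div (p k : ℕ) :
    ∏ i ∈ range k, (1 + (p : ℚ) * ((i + 1 : ℕ) : ℚ)⁻¹) = (p + k).choose k := by
  induction k with
  | zero => simp
  | succ k ih =>
    have h := cast_choose_succ_succ_mul (p + k) k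
    rw [prod_range_succ, ih, ← add_assoc]
    push_cast at h ⊢
    field_simp
    linear_combination -h

theorem prod_one_sub_div {p : ℕ} (hp : 0 < p) (k : ℕ) :
    ∏ i ∈ range k, (1 + -((p : ℚ) * ((i + 1 : ℕ) : ℚ)⁻¹)) = (-1) ^ k * (p - 1).choose k := by
  induction k with
  | zero => simp
  | succ k ih =>
    have h := cast_choose_succ_right (p - 1) k
    rw [Nat.cast_sub hp] at h
    rw [prod_range_succ, ih, pow_succ]
    push_cast at h ⊢
    field_simp
    linear_combination h

theorem sum_range_natCast_zmod (p : ℕ) [NeZero p] {M : Type*} [AddCommMonoid M]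
    (f : ZMod p → M) : ∑ i ∈ range p, f i = ∑ x, f x :=
  sum_nbij' (fun i => (i : ZMod p)) ZMod.val (by simp) (by simp [ZMod.val_lt])
    (fun i hi => ZMod.val_cast_of_lt (mem_range.mp hi)) (by simp) (by simp)

theorem not_dvd_of_pos_of_lt_two_mul {p n : ℕ} (h₀ : 0 < n) (h₁ : n ≠ p) (h₂ : n < 2 * p) :
    ¬p ∣ n := by
  rintro ⟨c, rfl⟩
  have hc : c < 2 := by
    by_contra hc
    nlinarith
  interval_cases c <;> simp_all

theorem sum_inv_sq_mem {p : ℕ} [hp : Fact p.Prime] (hp3 : 3 < p) :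
    ∑ i ∈ range (p - 1), (((i + 1 : ℕ) : ℚ)⁻¹) ^ 2 ∈ padicBall p 1 := by
  have hdvd : ∀ i ∈ range (p - 1), i + 1 ∣ (p - 1).factorial := fun i hi =>
    Nat.dvd_factorial i.succ_pos (by have := mem_range.mp hi; omega)
  have hfac : ¬p ∣ (p - 1).factorial := by
    rw [hp.out.dvd_factorial]
    omega
  have hN : p ∣ ∑ i ∈ range (p - 1), ((p - 1).factorial / (i + 1)) ^ 2 := by
    rw [← ZMod.natCast_eq_zero_iff]
    have hz : ∑ i ∈ range (p - 1), (((i + 1 : ℕ) : ZMod p)⁻¹) ^ 2 = 0 := by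
      have h₁ := sum_range_natCast_zmod p fun x : ZMod p => (x⁻¹) ^ 2
      have h₂ : ∑ x : ZMod p, (x⁻¹) ^ 2 = ∑ x : ZMod p, x ^ 2 :=
        sum_nbij' (fun x => x⁻¹) (fun x => x⁻¹) (by simp) (by simp) (by simp) (by simp) (by simp)
      rw [h₂, FiniteField.sum_pow_lt_card_sub_one (ZMod p) 2 (by rw [ZMod.card]; omega)] at h₁
      rw [range_eq_Ico, sum_eq_sum_Ico_succ_bot hp.out.pos, sum_Ico_eq_sum_range] at h₁
      simpa [add_comm] using h₁
    push_cast
    calc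
      _ = ∑ i ∈ range (p - 1), ((p - 1).factorial : ZMod p) ^ 2 *
            (((i + 1 : ℕ) : ZMod p)⁻¹) ^ 2 := by
        refine sum_congr rfl fun i hi => ?_
        have hi0 : ((i + 1 : ℕ) : ZMod p) ≠ 0 := by
          rw [Ne, ZMod.natCast_eq_zero_iff]
          have := mem_range.mp hi
          exact not_dvd_of_pos_of_lt_two_mul i.succ_pos (by omega) (by omega)
        rw [Nat.cast_div (hdvd i hi) hi0, div_eq_mul_inv, mul_pow]
      _ = 0 := by rw [← mul_sum, hz, mul_zero]
  refine mem_padicBall_of_natCast_mul (n := (p - 1).factorial ^ 2)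
    (fun h => hfac (hp.out.dvd_of_dvd_pow h)) ?_
  convert natCast_mem_padicBall_one hN using 1
  rw [mul_sum]
  push_cast
  refine sum_congr rfl fun i hi => ?_
  rw [Nat.cast_div (hdvd i hi) (by positivity)]
  push_cast
  rw [div_eq_mul_inv, mul_pow]

theorem choose_two_mul_sub_one_sub_one_mem {p : ℕ} [hp : Fact p.Prime] (hp3 : 3 < p) :
    ((2 * p - 1).choose (p - 1) : ℚ) - 1 ∈ padicBall p 3 := by
  have hpos := hp.out.pos
  have hW : ((2 * p - 1).choose (p - 1) : ℚ) =
      ∏ i ∈ range (p - 1), (1 + -((p : ℚ) ^ 2 * (((i + 1 : ℕ) : ℚ)⁻¹) ^ 2)) := by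
    have h₁ := prod_one_sub_div hpos (p - 1)
    rw [Nat.choose_self, (hp.out.even_sub_one (by omega)).neg_one_pow] at h₁
    have h₂ := prod_one_add_div p (p - 1)
    rw [show p + (p - 1) = 2 * p - 1 by omega] at h₂
    calc
      _ = ((2 * p - 1).choose (p - 1) : ℚ) * (1 * (1 : ℕ)) := by simp
      _ = _ := by
        rw [← h₁, ← h₂, ← prod_mul_distrib]
        exact prod_congr rfl fun i _ => by ring
  have hp2 : (p : ℚ) ^ 2 ∈ padicBall p 2 := by
    rw [sq]
    exact padicBall_mul prime_mem_padicBall prime_mem_padicBall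
  have hx : ∀ i ∈ range (p - 1),
      -((p : ℚ) ^ 2 * (((i + 1 : ℕ) : ℚ)⁻¹) ^ 2) ∈ padicBall p 2 := by
    intro i hi
    have := mem_range.mp hi
    have hi := inv_natCast_mem_padicBall (p := p) (n := i + 1)
      (not_dvd_of_pos_of_lt_two_mul i.succ_pos (by omega) (by omega))
    rw [sq (_⁻¹)]
    exact neg_mem (padicBall_mul hp2 (padicBall_mul hi hi))
  have h₁ := padicBall_anti (show 3 ≤ 2 + 2 by omega) (prod_one_add_sub_one_sub_sum_mem _ hx)
  have h₂ := padicBall_mul hp2 (sum_inv_sq_mem (p := p) hp3)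
  rw [← hW, sum_neg_distrib, ← mul_sum] at h₁
  convert sub_mem h₁ h₂ using 1
  ring

/-! ### Reduction of the closed form modulo `p ^ 4` -/

section Reduction

variable {p : ℕ} [hp : Fact p.Prime]

theorem prime_div_mem {n : ℕ} (h₀ : 0 < n) (h₁ : n ≠ p) (h₂ : n < 2 * p) :
    (p : ℚ) * (n : ℚ)⁻¹ ∈ padicBall p 1 :=
  padicBall_mul prime_mem_padicBall
    (inv_natCast_mem_padicBall (not_dvd_of_pos_of_lt_two_mul h₀ h₁ h₂))

theorem shiftProd_mem (j : ℕ) : shiftProd p j ∈ padicBall p 0 := by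
  rw [shiftProd, prod_one_add_div, prod_one_sub_div hp.out.pos]
  have h := natCast_mem_padicBall (p := p) ((p + 2 * j).choose (2 * j) * (p - 1).choose j)
  rcases neg_one_pow_eq_or ℚ j with hs | hs <;> rw [hs]
  · convert h using 1
    push_cast
    ring
  · convert neg_mem h using 1
    push_cast
    ring

theorem shiftProd_sub_mem {j : ℕ} (hj : 2 * j < p) :
    shiftProd p j - (1 + (p : ℚ) * harmonic (2 * j) - (p : ℚ) * harmonic j) ∈ padicBall p 2 := by
  have hx : ∀ k < p, ∀ i ∈ range k, (p : ℚ) * ((i + 1 : ℕ) : ℚ)⁻¹ ∈ padicBall p 1 := by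
    intro k hk i hi
    have := mem_range.mp hi
    exact prime_div_mem i.succ_pos (by omega) (by omega)
  have hA := hx (2 * j) hj
  have hB : ∀ i ∈ range j, -((p : ℚ) * ((i + 1 : ℕ) : ℚ)⁻¹) ∈ padicBall p 1 :=
    fun i hi => neg_mem (hx j (by omega) i hi)
  have h := add_mem (add_mem (prod_one_add_sub_one_sub_sum_mem _ hA)
    (prod_one_add_sub_one_sub_sum_mem _ hB))
    (padicBall_mul (prod_one_add_sub_one_mem _ hA) (prod_one_add_sub_one_mem _ hB))
  convert h using 1
  rw [shiftProd, harmonic, harmonic, sum_neg_distrib, ← mul_sum, ← mul_sum]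
  ring

theorem shiftProd_sub_two_mem {j : ℕ} (hj : p < 2 * j + 1) (hjp : j < p) :
    shiftProd p j - 2 ∈ padicBall p 1 := by
  have hp1 := hp.out.one_lt
  have hA : ∀ i ∈ (range (2 * j)).erase (p - 1),
      (p : ℚ) * ((i + 1 : ℕ) : ℚ)⁻¹ ∈ padicBall p 1 := by
    intro i hi
    obtain ⟨hne, hlt⟩ := mem_erase.mp hi
    have := mem_range.mp hlt
    exact prime_div_mem i.succ_pos (by omega) (by omega)
  have hB : ∀ i ∈ range j, -((p : ℚ) * ((i + 1 : ℕ) : ℚ)⁻¹) ∈ padicBall p 1 := by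
    intro i hi
    have := mem_range.mp hi
    exact neg_mem (prime_div_mem i.succ_pos (by omega) (by omega))
  have h := padicBall_mul (natCast_mem_padicBall (p := p) 2)
    (mul_sub_one_mem (prod_one_add_sub_one_mem _ hA) (prod_one_add_sub_one_mem _ hB))
  rw [zero_add] at h
  convert h using 1
  have hp0 : (p : ℚ) ≠ 0 := by exact_mod_cast hp.out.ne_zero
  rw [shiftProd, ← mul_prod_erase (range (2 * j)) _ (mem_range.mpr (by omega : p - 1 < 2 * j)),
    Nat.sub_add_cancel hp1.le, mul_inv_cancel₀ hp0]
  push_cast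
  ring

theorem inv_four_pow_mem (hp2 : p ≠ 2) (n : ℕ) : ((4 : ℚ) ^ n)⁻¹ ∈ padicBall p 0 := by
  have h4 : ¬p ∣ 4 ^ n := fun h =>
    hp2 ((Nat.prime_dvd_prime_iff_eq hp.out Nat.prime_two).mp
      (hp.out.dvd_of_dvd_pow (show p ∣ 2 ^ (2 * n) by rw [pow_mul]; exact h)))
  exact_mod_cast inv_natCast_mem_padicBall h4

theorem inv_four_pow_mul_mem (hp2 : p ≠ 2) {j : ℕ} (h : 2 * j + 1 ≠ p) (hj : j < p) :
    ((4 : ℚ) ^ j * (2 * j + 1))⁻¹ ∈ padicBall p 0 := by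
  have hinv := inv_natCast_mem_padicBall
    (not_dvd_of_pos_of_lt_two_mul (Nat.succ_pos (2 * j)) h (by omega))
  push_cast at hinv
  rw [mul_inv]
  exact padicBall_mul (inv_four_pow_mem hp2 j) hinv

theorem lower_term_mem (hp3 : 3 < p) {j : ℕ} (hj : 2 * j + 1 < p) :
    ((2 * p - 1).choose (p - 1) : ℚ) *
        (p * ((2 * j).choose j / (4 ^ j * (2 * j + 1)) * shiftProd p j)) -
      p * (((2 * j).choose j : ℚ) / 4 ^ j *
        (1 + (p : ℚ) * harmonic (2 * j) - (p : ℚ) * harmonic j) / (2 * (j : ℚ) + 1)) ∈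
      padicBall p 3 := by
  have hW := padicBall_anti (show 2 ≤ 3 by omega) (choose_two_mul_sub_one_sub_one_mem (p := p) hp3)
  have hS := shiftProd_sub_mem (p := p) (j := j) (by omega)
  have ha := padicBall_mul (natCast_mem_padicBall (p := p) ((2 * j).choose j))
    (inv_four_pow_mul_mem (p := p) (by omega) hj.ne (by omega))
  have hS0 := shiftProd_mem (p := p) j
  have h := padicBall_mul (padicBall_mul prime_mem_padicBall ha)
    (add_mem (padicBall_mul hS0 hW) hS)
  convert h using 1
  field_simp
  ring

theorem middle_term_mem (hp3 : 3 < p) {m : ℕ} (hm : p = 2 * m + 1) :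
    ((2 * p - 1).choose (p - 1) : ℚ) *
        (p * ((2 * m).choose m / (4 ^ m * (2 * m + 1)) * shiftProd p m)) -
      ((2 * p - 1).choose (p - 1) : ℚ) * ((p - 1).choose m : ℚ) ^ 2 / (-4) ^ m ∈
      padicBall p 3 := by
  have hW := choose_two_mul_sub_one_sub_one_mem (p := p) hp3
  have hS : shiftProd p m = (2 * p - 1).choose (p - 1) * ((-1) ^ m * (p - 1).choose m) := by
    rw [shiftProd, prod_one_sub_div hp.out.pos, prod_one_add_div,
      show p + 2 * m = 2 * p - 1 by omega, show 2 * m = p - 1 by omega]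
  have hs : ((-1 : ℚ) ^ m) = 1 ∨ ((-1 : ℚ) ^ m) = -1 := neg_one_pow_eq_or ℚ m
  have h1 : (-1 : ℚ) ^ m ∈ padicBall p 0 := by
    rcases hs with h | h <;> rw [h]
    · exact one_mem_padicBall
    · exact neg_mem one_mem_padicBall
  have ha := padicBall_mul (padicBall_mul (natCast_mem_padicBall (p := p)
    ((2 * p - 1).choose (p - 1) * (p - 1).choose m ^ 2)) h1) (inv_four_pow_mem (by omega) m)
  have h := padicBall_mul ha hW
  convert h using 1
  have hpm : (2 * (m : ℚ) + 1) = p := by rw [hm]; push_cast; ring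
  have hp0 : (p : ℚ) ≠ 0 := by exact_mod_cast hp.out.ne_zero
  rw [hS, hpm, show 2 * m = p - 1 by omega, show (-4 : ℚ) ^ m = (-1) ^ m * 4 ^ m by
    rw [← mul_pow]; norm_num]
  push_cast
  rcases hs with h | h <;> rw [h] <;> ring_nf <;> field_simp

theorem upper_term_mem (hp3 : 3 < p) {j : ℕ} (hj : p < 2 * j + 1) (hjp : j < p) :
    ((2 * p - 1).choose (p - 1) : ℚ) *
        (p * ((2 * j).choose j / (4 ^ j * (2 * j + 1)) * shiftProd p j)) -
      2 * p * (((2 * j).choose j : ℚ) / ((2 * (j : ℚ) + 1) * 4 ^ j)) ∈ padicBall p 3 := by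
  have hp2 : p ≠ 2 * j := fun h => by
    have := (hp.out.eq_one_or_self_of_dvd 2 ⟨j, h⟩)
    omega
  have hW := padicBall_anti (show 1 ≤ 3 by omega) (choose_two_mul_sub_one_sub_one_mem (p := p) hp3)
  have hS := shiftProd_sub_two_mem (p := p) hj hjp
  have hC := natCast_mem_padicBall_one
    (hp.out.dvd_choose hjp (by omega) (by omega : p ≤ 2 * j))
  have ha := padicBall_mul hC (inv_four_pow_mul_mem (p := p) (by omega) hj.ne' hjp)
  have hWS := add_mem (padicBall_mul (natCast_mem_padicBall (p := p) 2) hW)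
    (padicBall_mul (natCast_mem_padicBall (p := p) ((2 * p - 1).choose (p - 1))) hS)
  have h := padicBall_mul (padicBall_mul prime_mem_padicBall ha) hWS
  convert h using 1
  push_cast
  field_simp
  ring

end Reduction

end FranelCongruence

open FranelCongruence

/-- The congruence (2.3): for a prime `p > 3`,
`∑_{k=0}^{p-1} (3k+1)/(-16)^k C(2k,k) f_k ≡ (p/4^{p-1})(S₁ + S₂ + S₃) (mod p^4)`
as rational numbers, where
`S₁ = p ∑_{j=0}^{(p-3)/2} C(2j,j)/4^j (1 + p H_{2j} - p H_j)/(2j+1)`,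
`S₂ = C(2p-1,p-1) C(p-1,(p-1)/2)^2 / (-4)^{(p-1)/2}`, and
`S₃ = 2p ∑_{j=(p+1)/2}^{p-1} C(2j,j)/((2j+1) 4^j)`. -/
theorem main_congruence (p : ℕ) (hp : p.Prime) (hp3 : 3 < p) :
    ((p : ℤ)) ^ 4 ∣
      ((∑ k ∈ Finset.range p,
          (3 * (k : ℚ) + 1) / (-16) ^ k * ((2 * k).choose k : ℚ) * (franel k : ℚ)) -
        (p : ℚ) / 4 ^ (p - 1) *
          ((p : ℚ) * ∑ j ∈ Finset.range ((p - 3) / 2 + 1),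
              ((2 * j).choose j : ℚ) / 4 ^ j *
                (1 + (p : ℚ) * harmonic (2 * j) - (p : ℚ) * harmonic j) / (2 * (j : ℚ) + 1) +
            ((2 * p - 1).choose (p - 1) : ℚ) * ((p - 1).choose ((p - 1) / 2) : ℚ) ^ 2 /
              (-4) ^ ((p - 1) / 2) +
            2 * (p : ℚ) * ∑ j ∈ Finset.Icc ((p + 1) / 2) (p - 1),
              ((2 * j).choose j : ℚ) / ((2 * (j : ℚ) + 1) * 4 ^ j))).num := by
  have := Fact.mk hp
  obtain ⟨m, hm⟩ := hp.odd_of_ne_two (by omega)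
  have hsum : ∀ f : ℕ → ℚ, ∑ j ∈ Finset.range p, f j =
      ∑ j ∈ Finset.range m, f j + f m + ∑ j ∈ Finset.Icc (m + 1) (p - 1), f j := by
    intro f
    have hIcc : Finset.Icc (m + 1) (p - 1) = Finset.Ico (m + 1) p := by
      ext j
      simp only [Finset.mem_Icc, Finset.mem_Ico]
      omega
    rw [← Finset.sum_range_succ, hIcc, Finset.sum_range_add_sum_Ico _ (by omega)]
  rw [show (p - 3) / 2 + 1 = m by omega, show (p - 1) / 2 = m by omega,
    show (p + 1) / 2 = m + 1 by omega]
  refine pow_dvd_num_of_mem_padicBall ?_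
  rw [sum_franel_eq hp.pos, hsum, ← mul_sub, Finset.mul_sum, Finset.mul_sum, div_eq_mul_inv]
  rw [add_sub_add_comm, add_sub_add_comm, ← Finset.sum_sub_distrib, ← Finset.sum_sub_distrib]
  refine padicBall_mul (r := 1) (s := 3)
    (padicBall_mul prime_mem_padicBall (inv_four_pow_mem (by omega) _))
    (add_mem (add_mem (sum_mem fun j hj => ?_) (middle_term_mem hp3 hm)) (sum_mem fun j hj => ?_))
  · have := Finset.mem_range.mp hj
    exact lower_term_mem hp3 (by omega)
  · have := Finset.mem_Icc.mp hj
    exact upper_term_mem hp3 (by omega) (by omega)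
end
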